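/- Let 𝐏 = (P_1,…,P_k) be a collection of d-dimensional lattice polytopes in ℝ^d. Then there exists a positive integer R (depending on 𝐏) such that for all r ≥ R, the mixed h*-vector (h_0*(r𝐏),…,h_d*(r𝐏)) of the dilated collection r𝐏 = (rP_1,…,rP_k) is log-concave (h_i*(r𝐏)^2 ≥ h_{i−1}*(r𝐏) h_{i+1}*(r𝐏) for all 1 ≤ i ≤ d−1) and unimodal (there exists 0 ≤ ℓ ≤ d with h_0*(r𝐏) ≤ ⋯ ≤ h_ℓ*(r𝐏) ≥ ⋯ ≥ h_d*(r𝐏)). -/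

import Mathlib

open Pointwise MeasureTheory Filter
open scoped Classical

/-- A lattice polytope in `ℝ^d`: the convex hull of finitely many integer points. -/
def IsLatticePolytope {d : ℕ} (P : Set (Fin d → ℝ)) : Prop :=
  ∃ V : Finset (Fin d → ℤ), V.Nonempty ∧
    P = convexHull ℝ ((fun z : Fin d → ℤ => fun i => (z i : ℝ)) '' ↑V)

/-- The number of lattice points of a subset of `ℝ^d`. -/
noncomputable def latticePointCount {d : ℕ} (P : Set (Fin d → ℝ)) : ℕ :=
  Set.ncard {z : Fin d → ℤ | (fun i => (z i : ℝ)) ∈ P}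

/-- The discrete mixed volume `DMV(P_1, …, P_k)`; here `∑ j ∈ J, P j` is a Minkowski
sum of sets, with the empty sum being `{0}`. -/
noncomputable def DMV {d k : ℕ} (P : Fin k → Set (Fin d → ℝ)) : ℤ :=
  ∑ J : Finset (Fin k), (-1) ^ (k - J.card) * (latticePointCount (∑ j ∈ J, P j) : ℤ)

/-- The dimension of a polytope: the dimension of its affine hull. -/
noncomputable def polytopeDim {d : ℕ} (P : Set (Fin d → ℝ)) : ℕ :=
  Module.finrank ℝ (affineSpan ℝ P).direction

section AsymptoticEulerian

/-- Eulerian numbers, indexed so that `n ^ d = ∑ i, eulerianCoeff d i * binom(n + d - i, d)`. -/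
def eulerianCoeff : ℕ → ℕ → ℝ
  | 0, 0 => 1
  | 0, _ + 1 => 0
  | _ + 1, 0 => 0
  | d + 1, i + 1 => (i + 1 : ℝ) * eulerianCoeff d (i + 1) + ((d : ℝ) + 1 - i) * eulerianCoeff d i

lemma eulerianCoeff_eq_zero (d : ℕ) : ∀ i, d < i → eulerianCoeff d i = 0 := by
  induction d with
  | zero => rintro (_ | i) hi <;> simp_all [eulerianCoeff]
  | succ d ih =>
    rintro (_ | i) hi
    · simp at hi
    · rw [eulerianCoeff, ih (i + 1) (by omega), ih i (by omega)]; simp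

lemma eulerianCoeff_pos (d : ℕ) : ∀ i, 1 ≤ i → i ≤ d → 0 < eulerianCoeff d i := by
  induction d with
  | zero => intro i h1 h2; omega
  | succ d ih =>
    rintro (_ | i) h1 h2
    · omega
    · rw [eulerianCoeff]
      have hd : (i : ℝ) ≤ d := by exact_mod_cast Nat.le_of_succ_le_succ h2
      have hc : (0 : ℝ) < (d : ℝ) + 1 - i := by linarith
      rcases Nat.eq_zero_or_pos i with rfl | hi
      · rcases Nat.eq_zero_or_pos d with rfl | hd'
        · simp [eulerianCoeff]
        · have := ih 1 le_rfl hd'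
          have h0 : eulerianCoeff d 0 = 0 := by
            obtain ⟨e, rfl⟩ : ∃ e, d = e + 1 := ⟨d - 1, by omega⟩
            rfl
          rw [h0]; simpa using this
      · have h3 := ih i hi (by omega)
        have h4 : 0 ≤ eulerianCoeff d (i + 1) := by
          rcases Nat.lt_or_ge d (i + 1) with h | h
          · exact (eulerianCoeff_eq_zero d _ h).ge
          · exact (ih _ (by omega) h).le
        positivity

lemma eulerianCoeff_nonneg (d i : ℕ) : 0 ≤ eulerianCoeff d i := by
  rcases Nat.lt_or_ge d i with h | h
  · exact (eulerianCoeff_eq_zero d i h).ge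
  · rcases Nat.eq_zero_or_pos i with rfl | hi
    · cases d <;> simp [eulerianCoeff]
    · exact (eulerianCoeff_pos d i hi h).le

/-- Strict log-concavity of the Eulerian numbers. -/
lemma eulerianCoeff_mul_lt_sq (d : ℕ) : ∀ i, i + 1 ≤ d →
    eulerianCoeff d i * eulerianCoeff d (i + 2) < eulerianCoeff d (i + 1) ^ 2 := by
  induction d with
  | zero => intro i h; omega
  | succ d ih =>
    rintro (_ | i) hi
    · have := eulerianCoeff_pos (d + 1) 1 le_rfl (by omega)
      have h0 : eulerianCoeff (d + 1) 0 = 0 := rfl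
      rw [h0, zero_mul]
      exact pow_pos this 2
    · have hpos := eulerianCoeff_pos (d + 1) (i + 2) (by omega) (by omega)
      rcases Nat.lt_or_ge d (i + 2) with h | h
      · rw [eulerianCoeff_eq_zero (d + 1) (i + 1 + 2) (by omega), mul_zero]
        exact pow_pos hpos 2
      · have ha := ih i (by omega)
        have hb := ih (i + 1) (by omega)
        have hp1 := eulerianCoeff_pos d (i + 1) (by omega) (by omega)
        have hp2 := eulerianCoeff_pos d (i + 2) (by omega) (by omega)
        have hn0 := eulerianCoeff_nonneg d i
        have hn3 := eulerianCoeff_nonneg d (i + 3)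
        have hM : (i : ℝ) + 2 ≤ d := by exact_mod_cast h
        rw [show i + 1 + 2 = (i + 2) + 1 from rfl, show i + 1 + 1 = (i + 1) + 1 from rfl,
          eulerianCoeff, eulerianCoeff, eulerianCoeff]
        push_cast
        rw [show i + 1 + 1 = i + 2 from rfl, show i + 2 + 1 = i + 3 from rfl] at *
        rw [show i + 1 + 2 = i + 3 from rfl] at hb
        generalize eulerianCoeff d i = w at *
        generalize eulerianCoeff d (i + 1) = x at *
        generalize eulerianCoeff d (i + 2) = y at *
        generalize eulerianCoeff d (i + 3) = z at *
        have hwz : w * z ≤ x * y := by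
          have h1 : (w * y) * (x * z) ≤ x ^ 2 * y ^ 2 := by gcongr
          have h2 : (w * z) * (x * y) ≤ (x * y) * (x * y) := by nlinarith
          exact le_of_mul_le_mul_right h2 (by positivity)
        generalize hMdef : (d : ℝ) - i = M at *
        have hM2 : 2 ≤ M := by linarith
        have hd : (d : ℝ) = M + i := by linarith
        rw [hd]
        have e1 : 0 ≤ (y - x) ^ 2 := sq_nonneg _
        have hi0 : (0 : ℝ) ≤ i := by positivity
        have e2 : 0 ≤ (((i : ℝ) + 2) ^ 2 - 1) * (y ^ 2 - x * z) :=
          mul_nonneg (by nlinarith) (by linarith)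
        have e3 : 0 < (M ^ 2 - 1) * (x ^ 2 - w * y) :=
          mul_pos (by nlinarith) (by linarith)
        have e4 : 0 ≤ ((i : ℝ) + 3) * (M + 1) * (x * y - w * z) :=
          mul_nonneg (by positivity) (by linarith)
        nlinarith

lemma worpitzky_step (n d i : ℕ) (hi : i ≤ d) :
    (n : ℝ) * ((n + d - i).choose d : ℕ) =
      (i : ℝ) * ((n + (d + 1) - i).choose (d + 1) : ℕ)
        + ((d : ℝ) + 1 - i) * ((n + (d + 1) - (i + 1)).choose (d + 1) : ℕ) := by
  obtain ⟨e, rfl⟩ : ∃ e, d = i + e := ⟨d - i, by omega⟩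
  rw [show n + (i + e) - i = n + e by omega, show n + (i + e + 1) - i = n + e + 1 by omega,
    show n + (i + e + 1) - (i + 1) = n + e by omega, Nat.choose_succ_succ]
  rcases Nat.lt_or_ge (n + e) (i + e) with h | h
  · rw [Nat.choose_eq_zero_of_lt h, Nat.choose_eq_zero_of_lt (by omega : n + e < i + e + 1)]
    simp
  · have := Nat.choose_succ_right_eq (n + e) (i + e)
    have h2 : (((n + e).choose (i + e + 1) : ℕ) : ℝ) * ((i : ℝ) + e + 1)
        = ((n + e).choose (i + e) : ℕ) * ((n : ℝ) - i) := by
      rw [show n + e - (i + e) = n - i by omega] at this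
      have h3 : (((n + e).choose (i + e + 1) * (i + e + 1) : ℕ) : ℝ)
        = ((n + e).choose (i + e) * (n - i) : ℕ) := by exact_mod_cast this
      push_cast [Nat.cast_sub (by omega : i ≤ n)] at h3
      linarith
    push_cast
    linarith

/-- Worpitzky's identity. -/
lemma worpitzky (d n : ℕ) :
    (n : ℝ) ^ d = ∑ i ∈ Finset.range (d + 1), eulerianCoeff d i * ((n + d - i).choose d : ℕ) := by
  induction d with
  | zero => simp [eulerianCoeff]
  | succ d ih =>
    rw [pow_succ', ih, Finset.mul_sum, Finset.sum_range_succ' _ (d + 1)]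
    have h0 : eulerianCoeff (d + 1) 0 = 0 := rfl
    rw [h0, zero_mul, add_zero]
    have hstep : ∀ i ∈ Finset.range (d + 1),
        (n : ℝ) * (eulerianCoeff d i * ((n + d - i).choose d : ℕ)) =
          (i : ℝ) * eulerianCoeff d i * ((n + (d + 1) - i).choose (d + 1) : ℕ) +
          ((d : ℝ) + 1 - i) * eulerianCoeff d i
            * ((n + (d + 1) - (i + 1)).choose (d + 1) : ℕ) := by
      intro i hi
      have := worpitzky_step n d i (by simp at hi; omega)
      linear_combination eulerianCoeff d i * this
    rw [Finset.sum_congr rfl hstep, Finset.sum_add_distrib, Finset.sum_range_succ']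
    have hsplit : ∀ i, eulerianCoeff (d + 1) (i + 1)
          * ((n + (d + 1) - (i + 1)).choose (d + 1) : ℕ) =
        ((i + 1 : ℕ) : ℝ) * eulerianCoeff d (i + 1) * ((n + (d + 1) - (i + 1)).choose (d + 1) : ℕ)
        + ((d : ℝ) + 1 - i) * eulerianCoeff d i
            * ((n + (d + 1) - (i + 1)).choose (d + 1) : ℕ) := by
      intro i
      rw [eulerianCoeff]; push_cast; ring
    simp_rw [hsplit]
    rw [Finset.sum_add_distrib]
    congr 1
    rw [Finset.sum_range_succ, eulerianCoeff_eq_zero d (d + 1) (by omega)]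
    simp

lemma tendsto_choose_shift_div_pow (d i : ℕ) (hi : i ≤ d) :
    Tendsto (fun n : ℕ => (((n + d - i).choose d : ℕ) : ℝ) / (n : ℝ) ^ d) atTop
      (nhds (1 / (d.factorial : ℝ))) := by
  obtain ⟨e, rfl⟩ : ∃ e, d = i + e := ⟨d - i, by omega⟩
  have h1 : Tendsto (fun n : ℕ => ((n.choose (i + e) : ℕ) : ℝ) / (n : ℝ) ^ (i + e)) atTop
      (nhds (1 / ((i + e).factorial : ℝ))) := by
    have h := isEquivalent_choose (i + e)
    have h2 := (Asymptotics.isEquivalent_iff_tendsto_one (by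
      filter_upwards [eventually_gt_atTop 0] with n hn
      positivity)).1 h
    have h3 := h2.mul_const (1 / ((i + e).factorial : ℝ))
    rw [one_mul] at h3
    refine h3.congr' ?_
    filter_upwards [eventually_gt_atTop 0] with n hn
    simp only [Pi.div_apply]
    field_simp
  have h2 : Tendsto (fun n : ℕ => ((((n + e).choose (i + e) : ℕ) : ℝ)
      / ((n + e : ℕ) : ℝ) ^ (i + e)) * (((n + e : ℕ) : ℝ) / (n : ℝ)) ^ (i + e)) atTop
      (nhds (1 / ((i + e).factorial : ℝ) * 1 ^ (i + e))) := by
    refine (h1.comp (tendsto_add_atTop_nat e)).mul (Tendsto.pow ?_ _)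
    have : Tendsto (fun n : ℕ => 1 + (e : ℝ) / (n : ℝ)) atTop (nhds (1 + 0)) :=
      tendsto_const_nhds.add (tendsto_const_div_atTop_nhds_zero_nat (e : ℝ))
    rw [add_zero] at this
    refine this.congr' ?_
    filter_upwards [eventually_gt_atTop 0] with n hn
    push_cast; field_simp
  rw [one_pow, mul_one] at h2
  refine h2.congr' ?_
  filter_upwards [eventually_gt_atTop 0] with n hn
  rw [show n + (i + e) - i = n + e by omega]
  have : (0 : ℝ) < ((n + e : ℕ) : ℝ) := by positivity
  rw [div_pow]
  field_simp

/-- A log-concave sequence, positive on `1, …, d` and increasing at `0`, is unimodal. -/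
lemma unimodal_of_logConcave {d : ℕ} (hd : 1 ≤ d) (a : ℕ → ℝ) (h01 : a 0 < a 1)
    (hpos : ∀ i, 1 ≤ i → i ≤ d → 0 < a i)
    (hlc : ∀ i, 1 ≤ i → i + 1 ≤ d → a (i - 1) * a (i + 1) ≤ a i ^ 2) :
    ∃ l : ℕ, l ≤ d ∧ (∀ i j : ℕ, i ≤ j → j ≤ l → a i ≤ a j) ∧
        (∀ i j : ℕ, l ≤ i → i ≤ j → j ≤ d → a j ≤ a i) := by
  have hex : ∃ l, l = d ∨ a (l + 1) ≤ a l := ⟨d, Or.inl rfl⟩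
  have hmin := fun m => Nat.find_min hex (m := m)
  have hle : Nat.find hex ≤ d := Nat.find_min' hex (Or.inl rfl)
  have hspec := Nat.find_spec hex
  set l := Nat.find hex
  have hl1 : 1 ≤ l := by
    by_contra hlt
    have : l = 0 := by omega
    rw [this] at hspec
    rcases hspec with h | h
    · omega
    · linarith
  have hdec : ∀ i, l ≤ i → i + 1 ≤ d → a (i + 1) ≤ a i := by
    intro i hi
    induction i, hi using Nat.le_induction with
    | base =>
      intro h
      rcases hspec with h' | h'
      · omega
      · exact h'
    | succ i hi ih =>
      intro h
      have h1 := ih (by omega)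
      have h2 := hlc (i + 1) (by omega) h
      simp only [Nat.add_sub_cancel] at h2
      have p1 := hpos i (by omega) (by omega)
      have p2 := hpos (i + 1) (by omega) (by omega)
      have : a i * a (i + 1 + 1) ≤ a i * a (i + 1) := by nlinarith
      exact le_of_mul_le_mul_left this p1
  refine ⟨l, hle, ?_, ?_⟩
  · intro i j hij
    induction j, hij using Nat.le_induction with
    | base => intro; exact le_rfl
    | succ j hj ih =>
      intro h
      have := hmin j (by omega)
      push Not at this
      exact (ih (by omega)).trans this.2.le
  · intro i j hli hij
    induction j, hij using Nat.le_induction with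
    | base => intro; exact le_rfl
    | succ j hj ih => intro h; exact (hdec j (by omega) h).trans (ih (by omega))

/-- If `F (r n)` is the value at `n` of the polynomial with `h^*`-vector `h r`, and `F` either
vanishes or grows like the `d`-th power, then `h r` is log-concave and unimodal for large `r`. -/
lemma logConcave_unimodal_of_growth {d : ℕ} (F : ℕ → ℝ) (h : ℕ → ℕ → ℝ)
    (hh : ∀ r : ℕ, 1 ≤ r → ∀ n : ℕ,
      F (r * n) = ∑ i ∈ Finset.range (d + 1), h r i * ((n + d - i).choose d : ℕ))
    (hF : (∀ n, F n = 0) ∨ ∃ c : ℝ, 0 < c ∧ ∀ᶠ n : ℕ in atTop, c * (n : ℝ) ^ d ≤ F n) :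
    ∃ R : ℕ, 1 ≤ R ∧ ∀ r : ℕ, R ≤ r →
      (∀ i : ℕ, 1 ≤ i → i + 1 ≤ d → h r (i - 1) * h r (i + 1) ≤ (h r i) ^ 2) ∧
      ∃ l : ℕ, l ≤ d ∧
        (∀ i j : ℕ, i ≤ j → j ≤ l → h r i ≤ h r j) ∧
        (∀ i j : ℕ, l ≤ i → i ≤ j → j ≤ d → h r j ≤ h r i) := by
  rcases Nat.eq_zero_or_pos d with rfl | hd
  · refine ⟨1, le_rfl, fun r _ => ⟨fun i _ _ => by omega, 0, le_rfl, ?_, ?_⟩⟩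
    · intro i j h1 h2
      obtain rfl : i = j := by omega
      exact le_rfl
    · intro i j _ h1 h2
      obtain rfl : i = j := by omega
      exact le_rfl
  have hrec : ∀ r, 1 ≤ r → ∀ i, i ≤ d → h r i =
      F (r * i) - ∑ j ∈ Finset.range i, h r j * ((i + d - j).choose d : ℕ) := by
    intro r hr i hi
    have hsub : Finset.range (i + 1) ⊆ Finset.range (d + 1) := by
      intro x; simp; omega
    rw [hh r hr i, ← Finset.sum_subset hsub, Finset.sum_range_succ]
    · simp
    · intro x _ hx
      simp at hx
      rw [Nat.choose_eq_zero_of_lt (by omega)]; simp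
  rcases hF with hF | ⟨c, hc, hF⟩
  · have hz : ∀ r, 1 ≤ r → ∀ i, i ≤ d → h r i = 0 := by
      intro r hr i
      induction i using Nat.strong_induction_on with
      | _ i ih =>
        intro hi
        rw [hrec r hr i hi, hF, Finset.sum_eq_zero, sub_zero]
        intro j hj
        simp at hj
        rw [ih j hj (by omega), zero_mul]
    refine ⟨1, le_rfl, fun r hr => ⟨fun i h1 h2 => ?_, d, le_rfl, ?_, ?_⟩⟩
    · rw [hz r hr _ h2, hz r hr i (by omega)]; simp
    · intro i j h1 h2
      rw [hz r hr _ h2, hz r hr i (by omega)]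
    · intro i j h1 h2 h3
      rw [hz r hr j h3, hz r hr i (by omega)]
  obtain ⟨e, he⟩ : ∃ e : ℝ, Tendsto (fun n : ℕ => F n / (n : ℝ) ^ d) atTop (nhds e) := by
    have : Tendsto (fun n : ℕ => ∑ i ∈ Finset.range (d + 1),
        h 1 i * ((((n + d - i).choose d : ℕ) : ℝ) / (n : ℝ) ^ d)) atTop
        (nhds (∑ i ∈ Finset.range (d + 1), h 1 i * (1 / (d.factorial : ℝ)))) := by
      refine tendsto_finsetSum _ fun i hi => ?_
      exact (tendsto_choose_shift_div_pow d i (by simp at hi; omega)).const_mul _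
    refine ⟨_, this.congr fun n => ?_⟩
    have := hh 1 le_rfl n
    rw [one_mul] at this
    rw [this, Finset.sum_div]
    simp_rw [mul_div_assoc]
  have hepos : 0 < e := by
    refine hc.trans_le (ge_of_tendsto he ?_)
    filter_upwards [hF, eventually_gt_atTop 0] with n hn hn0
    rwa [le_div_iff₀ (by positivity)]
  have hFr : ∀ m : ℕ, Tendsto (fun r : ℕ => F (r * m) / (r : ℝ) ^ d) atTop
      (nhds (e * (m : ℝ) ^ d)) := by
    intro m
    rcases Nat.eq_zero_or_pos m with rfl | hm
    · simp only [mul_zero, Nat.cast_zero]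
      rw [zero_pow (by omega), mul_zero]
      have : Tendsto (fun r : ℕ => (r : ℝ) ^ d) atTop atTop :=
        (tendsto_pow_atTop (by omega)).comp tendsto_natCast_atTop_atTop
      exact tendsto_const_nhds.div_atTop this
    · have h1 : Tendsto (fun r : ℕ => r * m) atTop atTop :=
        tendsto_id.atTop_mul_const' hm
      have h2 := (he.comp h1).mul_const ((m : ℝ) ^ d)
      refine h2.congr' ?_
      filter_upwards [eventually_gt_atTop 0] with r hr
      simp only [Function.comp]
      push_cast
      rw [mul_pow]
      field_simp
  have hlim : ∀ i, i ≤ d → Tendsto (fun r : ℕ => h r i / (r : ℝ) ^ d) atTop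
      (nhds (e * eulerianCoeff d i)) := by
    intro i
    induction i using Nat.strong_induction_on with
    | _ i ih =>
      intro hi
      have h1 : Tendsto (fun r : ℕ => F (r * i) / (r : ℝ) ^ d -
          ∑ j ∈ Finset.range i, h r j / (r : ℝ) ^ d * ((i + d - j).choose d : ℕ)) atTop
          (nhds (e * (i : ℝ) ^ d -
            ∑ j ∈ Finset.range i, e * eulerianCoeff d j * ((i + d - j).choose d : ℕ))) := by
        refine (hFr i).sub (tendsto_finsetSum _ fun j hj => ?_)
        simp at hj
        exact (ih j hj (by omega)).mul_const _
      have h2 : e * eulerianCoeff d i = e * (i : ℝ) ^ d -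
            ∑ j ∈ Finset.range i, e * eulerianCoeff d j * ((i + d - j).choose d : ℕ) := by
        have hsub : Finset.range (i + 1) ⊆ Finset.range (d + 1) := by
          intro x; simp; omega
        rw [worpitzky d i, ← Finset.sum_subset hsub, Finset.sum_range_succ, mul_add,
          Finset.mul_sum]
        · simp [mul_assoc]
        · intro x _ hx
          simp at hx
          rw [Nat.choose_eq_zero_of_lt (by omega)]; simp
      rw [h2]
      refine h1.congr' ?_
      filter_upwards [eventually_ge_atTop 1] with r hr
      rw [hrec r hr i hi, sub_div, Finset.sum_div]
      congr 1
      exact Finset.sum_congr rfl fun j _ => by ring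
  have hE0 : eulerianCoeff d 0 = 0 := by
    obtain ⟨e, rfl⟩ : ∃ e, d = e + 1 := ⟨d - 1, by omega⟩
    rfl
  have ev1 : ∀ᶠ r : ℕ in atTop, ∀ i ∈ Finset.Icc 1 d, 0 < h r i / (r : ℝ) ^ d := by
    rw [Filter.eventually_all_finset]
    intro i hi
    simp at hi
    exact (hlim i hi.2).eventually_const_lt (mul_pos hepos (eulerianCoeff_pos d i hi.1 hi.2))
  have ev2 : ∀ᶠ r : ℕ in atTop, h r 0 / (r : ℝ) ^ d < h r 1 / (r : ℝ) ^ d := by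
    refine (hlim 0 (by omega)).eventually_lt (hlim 1 hd) ?_
    rw [hE0, mul_zero]
    exact mul_pos hepos (eulerianCoeff_pos d 1 le_rfl hd)
  have ev3 : ∀ᶠ r : ℕ in atTop, ∀ i ∈ Finset.range (d - 1),
      h r i / (r : ℝ) ^ d * (h r (i + 2) / (r : ℝ) ^ d) < (h r (i + 1) / (r : ℝ) ^ d) ^ 2 := by
    rw [Filter.eventually_all_finset]
    intro i hi
    simp at hi
    refine ((hlim i (by omega)).mul (hlim (i + 2) (by omega))).eventually_lt
      ((hlim (i + 1) (by omega)).pow 2) ?_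
    have := eulerianCoeff_mul_lt_sq d i (by omega)
    have h2 : 0 < e ^ 2 := by positivity
    nlinarith
  obtain ⟨R, hR⟩ := eventually_atTop.1 (ev1.and (ev2.and ev3))
  refine ⟨max R 1, le_max_right _ _, fun r hr => ?_⟩
  obtain ⟨h1, h2, h3⟩ := hR r ((le_max_left _ _).trans hr)
  have hr1 : 0 < r := (le_max_right R 1).trans hr
  have hrd : (0 : ℝ) < (r : ℝ) ^ d := by positivity
  have hlc : ∀ i : ℕ, 1 ≤ i → i + 1 ≤ d → h r (i - 1) * h r (i + 1) ≤ (h r i) ^ 2 := by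
    intro i hi hid
    obtain ⟨i, rfl⟩ : ∃ j, i = j + 1 := ⟨i - 1, by omega⟩
    have := (h3 i (by simp; omega)).le
    rw [div_mul_div_comm, div_pow, ← sq, div_le_div_iff_of_pos_right (by positivity)] at this
    exact this
  refine ⟨hlc, unimodal_of_logConcave hd (h r) ?_ ?_ hlc⟩
  · exact (div_lt_div_iff_of_pos_right hrd).1 h2
  · intro i hi hid
    have := h1 i (by simp; omega)
    exact (div_pos_iff_of_pos_right hrd).1 this

end AsymptoticEulerian

section HalfOpenTriangulation

variable {ι E : Type*} [Fintype ι] [NormedAddCommGroup E] [NormedSpace ℝ E]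

/-- The vectors `A g`, `g ∈ B`, form a basis of the ambient space. -/
def IsSimplicialBasis (A : ι → E) (B : Finset ι) : Prop :=
  LinearIndepOn ℝ A (B : Set ι) ∧ Submodule.span ℝ (A '' (B : Set ι)) = ⊤

lemma LinearIndepOn.eq_of_sum_eq {A : ι → E} {B : Finset ι}
    (hB : LinearIndepOn ℝ A (B : Set ι)) {x y : ι → ℝ} (hx : ∀ g ∉ B, x g = 0)
    (hy : ∀ g ∉ B, y g = 0) (hxy : ∑ g, x g • A g = ∑ g, y g • A g) : x = y := by
  rw [linearIndepOn_finset_iff] at hB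
  have h := hB (fun g => x g - y g) (by
    rw [Finset.sum_subset (Finset.subset_univ B)]
    · simp [sub_smul, hxy]
    · intro g _ hg
      simp [hx g hg, hy g hg])
  ext g
  by_cases hg : g ∈ B
  · exact sub_eq_zero.1 (h g hg)
  · rw [hx g hg, hy g hg]

lemma IsSimplicialBasis.exists_coords {A : ι → E} {B : Finset ι} (hB : IsSimplicialBasis A B) :
    ∃ c : E →ₗ[ℝ] (ι → ℝ), (∀ s, ∀ g ∉ B, c s g = 0) ∧ (∀ s, ∑ g, c s g • A g = s) ∧
      ∀ x : ι → ℝ, (∀ g ∉ B, x g = 0) → c (∑ g, x g • A g) = x := by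
  let b := Module.Basis.mk (v := fun g : B => A g) hB.1 (by
    have h : Set.range (fun g : B => A g) = A '' (B : Set ι) := by ext; simp
    rw [h, hB.2])
  let c : E →ₗ[ℝ] (ι → ℝ) :=
    LinearMap.pi fun g => if h : g ∈ B then b.coord ⟨g, h⟩ else 0
  have h1 : ∀ s, ∀ g ∉ B, c s g = 0 := by
    intro s g hg
    simp [c, hg]
  have h2 : ∀ s, ∑ g, c s g • A g = s := by
    intro s
    rw [← Finset.sum_subset (Finset.subset_univ B) (fun g _ hg => by simp [h1 s g hg]),
      ← Finset.sum_coe_sort]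
    conv_rhs => rw [← b.sum_repr s]
    refine Finset.sum_congr rfl fun g _ => ?_
    have hb : b g = A g := Module.Basis.mk_apply _ _ _
    rw [hb]
    simp [c]
  exact ⟨c, h1, h2, fun x hx => hB.1.eq_of_sum_eq (h1 _) hx (h2 _)⟩

lemma LinearIndepOn.exists_isSimplicialBasis {A : ι → E}
    (hspan : Submodule.span ℝ (Set.range A) = ⊤) {S : Set ι} (hS : LinearIndepOn ℝ A S) :
    ∃ B : Finset ι, S ⊆ B ∧ IsSimplicialBasis A B := by
  obtain ⟨b, -, hSb, hb, hli⟩ := exists_linearIndepOn_extension hS (Set.subset_univ S)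
  refine ⟨b.toFinset, by simpa using hSb, by simpa using hli, ?_⟩
  rw [Set.coe_toFinset, eq_top_iff, ← hspan, Submodule.span_le, ← Set.image_univ]
  exact hb

lemma exists_mem_isOpen_forall_ne_zero (Φ : Set ((ι → ℝ) →ₗ[ℝ] ℝ)) (hΦ : Φ.Finite)
    (h0 : ∀ φ ∈ Φ, φ ≠ 0) {U : Set (ι → ℝ)} (hU : IsOpen U) (hne : U.Nonempty) :
    ∃ v ∈ U, ∀ φ ∈ Φ, φ v ≠ 0 := by
  have hd : Dense (⋂ φ ∈ Φ, {v : ι → ℝ | φ v ≠ 0}) := by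
    refine dense_biInter_of_isOpen ?_ hΦ.countable ?_
    · intro φ _
      have : Continuous φ := φ.continuous_of_finiteDimensional
      exact isOpen_ne_fun this continuous_const
    · intro φ hφ
      have h1 : {v : ι → ℝ | φ v ≠ 0} = ((LinearMap.ker φ : Submodule ℝ (ι → ℝ)) : Set _)ᶜ := by
        ext v; simp
      rw [h1, ← interior_eq_empty_iff_dense_compl]
      by_contra hne
      have := Submodule.eq_top_of_nonempty_interior' _ (Set.nonempty_iff_ne_empty.2 hne)
      exact h0 φ hφ (LinearMap.ker_eq_top.1 this)
  obtain ⟨v, hv, hvU⟩ := hd.inter_open_nonempty U hU hne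
  exact ⟨v, hv, by simpa using hvU⟩

lemma eventually_pos_add_mul_iff (a l : ℝ) (hl : l ≠ 0) :
    ∀ᶠ ε in nhdsWithin (0 : ℝ) (Set.Ioi 0),
      (0 < a + ε * l ↔ 0 ≤ a ∧ (l < 0 → 0 < a)) ∧ a + ε * l ≠ 0 := by
  have ht : Tendsto (fun ε : ℝ => a + ε * l) (nhdsWithin (0 : ℝ) (Set.Ioi 0)) (nhds a) := by
    have : Continuous (fun ε : ℝ => a + ε * l) := by fun_prop
    have h := (this.tendsto 0).mono_left (nhdsWithin_le_nhds (s := Set.Ioi (0 : ℝ)))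
    simpa using h
  rcases lt_trichotomy a 0 with ha | rfl | ha
  · filter_upwards [ht.eventually_lt_const ha] with ε hε
    exact ⟨⟨fun h => by linarith, fun h => by linarith [h.1]⟩, hε.ne⟩
  · filter_upwards [self_mem_nhdsWithin] with ε (hε : 0 < ε)
    refine ⟨?_, by simp [hε.ne', hl]⟩
    rw [zero_add, mul_pos_iff_of_pos_left hε]
    refine ⟨fun h => ⟨le_rfl, fun h' => by linarith⟩, fun h => ?_⟩
    rcases lt_or_gt_of_ne hl with h' | h'
    · exact absurd (h.2 h') (lt_irrefl 0)
    · exact h'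
  · filter_upwards [ht.eventually_const_lt ha] with ε hε
    exact ⟨⟨fun _ => ⟨ha.le, fun _ => ha⟩, fun _ => hε⟩, hε.ne'⟩

/-- A minimizer of a linear functional over a fibre of the positive orthant has no
feasible improving direction. -/
lemma nonneg_of_isMinOn_fibre {A : ι → E} {w x y : ι → ℝ} (hx : ∀ g, 0 ≤ x g)
    (hmin : ∀ z : ι → ℝ, (∀ g, 0 ≤ z g) → ∑ g, z g • A g = ∑ g, x g • A g →
      ∑ g, x g * w g ≤ ∑ g, z g * w g)
    (hy : ∑ g, y g • A g = 0) (hy0 : ∀ g, x g = 0 → 0 ≤ y g) : 0 ≤ ∑ g, y g * w g := by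
  have hev : ∀ᶠ ε in nhdsWithin (0 : ℝ) (Set.Ioi 0), ∀ g, 0 ≤ x g + ε * y g := by
    rw [Filter.eventually_all]
    intro g
    rcases (hx g).eq_or_lt with h | h
    · filter_upwards [self_mem_nhdsWithin] with ε (hε : 0 < ε)
      rw [← h, zero_add]
      exact mul_nonneg hε.le (hy0 g h.symm)
    · have : Continuous (fun ε : ℝ => x g + ε * y g) := by fun_prop
      have ht := (this.tendsto 0).mono_left (nhdsWithin_le_nhds (s := Set.Ioi (0 : ℝ)))
      have h' : (0 : ℝ) < x g + 0 * y g := by simpa using h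
      filter_upwards [ht.eventually_const_lt h'] with ε hε using hε.le
  obtain ⟨ε, hε, hpos⟩ := (hev.and self_mem_nhdsWithin).exists
  have hpos : 0 < ε := hpos
  have h := hmin (fun g => x g + ε * y g) hε (by
    simp only [add_smul, Finset.sum_add_distrib, mul_smul, ← Finset.smul_sum, hy]
    simp)
  simp only [add_mul, Finset.sum_add_distrib, mul_assoc, ← Finset.mul_sum] at h
  exact nonneg_of_mul_nonneg_right (by linarith) hpos

lemma exists_minimizer_fibre (A : ι → E) (ℓ : E →ₗ[ℝ] ℝ) (hℓ : ∀ g, ℓ (A g) = 1)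
    (w x₀ : ι → ℝ) (hx₀ : ∀ g, 0 ≤ x₀ g) :
    ∃ x : ι → ℝ, (∀ g, 0 ≤ x g) ∧ ∑ g, x g • A g = ∑ g, x₀ g • A g ∧
      ∀ z : ι → ℝ, (∀ g, 0 ≤ z g) → ∑ g, z g • A g = ∑ g, x g • A g →
        ∑ g, x g * w g ≤ ∑ g, z g * w g := by
  let K : Set (ι → ℝ) := {x | (∀ g, 0 ≤ x g) ∧ ∑ g, x g • A g = ∑ g, x₀ g • A g}
  have hclosed : IsClosed K := by
    refine IsClosed.inter ?_ ?_
    · have : {x : ι → ℝ | ∀ g, 0 ≤ x g} = ⋂ g, {x | 0 ≤ x g} := by ext; simp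
      change IsClosed {x : ι → ℝ | ∀ g, 0 ≤ x g}
      rw [this]
      exact isClosed_iInter fun g => isClosed_le continuous_const (continuous_apply g)
    · exact isClosed_eq (by fun_prop) continuous_const
  have hsum : ∀ x ∈ K, ∑ g, x g = ∑ g, x₀ g := by
    intro x hx
    have := congrArg ℓ hx.2
    simpa [hℓ] using this
  have hK : IsCompact K := by
    refine (isCompact_univ_pi (fun _ : ι => isCompact_Icc (a := (0 : ℝ))
      (b := ∑ g, x₀ g))).of_isClosed_subset hclosed ?_
    intro x hx g _
    refine ⟨hx.1 g, ?_⟩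
    rw [← hsum x hx]
    exact Finset.single_le_sum (fun i _ => hx.1 i) (Finset.mem_univ g)
  obtain ⟨x, hxK, hx⟩ := hK.exists_isMinOn ⟨x₀, hx₀, rfl⟩
    (f := fun x : ι → ℝ => ∑ g, x g * w g) (by fun_prop)
  exact ⟨x, hxK.1, hxK.2, fun z hz hzx => hx ⟨hz, hzx.trans hxK.2⟩⟩

/-- The vertices in `N` carry positive coefficients, the others in `B` nonnegative ones. -/
def IsHalfOpenCoeff (B N : Finset ι) (x : ι → ℝ) : Prop :=
  (∀ g ∉ B, x g = 0) ∧ (∀ g, 0 ≤ x g) ∧ ∀ g ∈ N, 0 < x g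

/-- Every optimal solution of a generic linear program is supported on a unique basis with
positive reduced costs. -/
lemma exists_optimal_basis {A : ι → E} {ℓ : E →ₗ[ℝ] ℝ} (hℓ : ∀ g, ℓ (A g) = 1)
    (hspan : Submodule.span ℝ (Set.range A) = ⊤) {c : Finset ι → E →ₗ[ℝ] (ι → ℝ)}
    (hc0 : ∀ B, IsSimplicialBasis A B → ∀ s, ∀ g ∉ B, c B s g = 0)
    (hcs : ∀ B, IsSimplicialBasis A B → ∀ s, ∑ g, c B s g • A g = s)
    {w : ι → ℝ} (hw : ∀ B, IsSimplicialBasis A B → ∀ j ∉ B, w j - ∑ g, c B (A j) g * w g ≠ 0)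
    {x₀ : ι → ℝ} (hx₀ : ∀ g, 0 ≤ x₀ g)
    (hgen : ∀ B, IsSimplicialBasis A B → ∀ g ∈ B, c B (∑ g, x₀ g • A g) g ≠ 0) :
    ∃ B, (IsSimplicialBasis A B ∧ ∀ j ∉ B, ∑ g, c B (A j) g * w g < w j) ∧
      ∀ g ∈ B, 0 < c B (∑ g, x₀ g • A g) g := by
  obtain ⟨x, hx, hxs, hmin⟩ := exists_minimizer_fibre A ℓ hℓ w x₀ hx₀
  have hkey : ∀ B, IsSimplicialBasis A B → ∀ j ∉ B, ∀ r : ℝ,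
      (∀ g, x g = 0 → 0 ≤ r * ((if g = j then 1 else 0) - c B (A j) g)) →
      0 ≤ r * (w j - ∑ g, c B (A j) g * w g) := by
    intro B hB j hj r hr
    have h := nonneg_of_isMinOn_fibre (y := fun g => r * ((if g = j then 1 else 0) - c B (A j) g))
      hx hmin (by
        simp only [mul_smul, sub_smul, ← Finset.smul_sum, Finset.sum_sub_distrib, hcs B hB]
        simp) hr
    simpa [mul_assoc, ← Finset.mul_sum, sub_mul, Finset.sum_sub_distrib] using h
  have hli : LinearIndepOn ℝ A {g | x g ≠ 0} := by
    obtain ⟨I, hI, -, hIspan, hIli⟩ := exists_linearIndepOn_extension (K := ℝ) (v := A)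
      (s := ∅) (t := {g | x g ≠ 0}) (linearIndepOn_empty ℝ A) (Set.empty_subset _)
    by_contra hdep
    obtain ⟨j, hj, hjI⟩ : ∃ j, x j ≠ 0 ∧ j ∉ I := by
      by_contra! hall
      exact hdep (hIli.mono fun g hg => hall g hg)
    obtain ⟨B, hIB, hB⟩ := hIli.exists_isSimplicialBasis hspan
    obtain ⟨f, hfI, hfs⟩ : ∃ f : ι → ℝ, (∀ g ∉ I, f g = 0) ∧ ∑ g, f g • A g = A j := by
      have hjm : A j ∈ Submodule.span ℝ (A '' I) := hIspan ⟨j, hj, rfl⟩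
      rw [Finsupp.mem_span_image_iff_linearCombination] at hjm
      obtain ⟨l, hl, hlj⟩ := hjm
      refine ⟨l, fun g hg => ?_, ?_⟩
      · by_contra hne
        exact hg ((Finsupp.mem_supported ℝ l).1 hl (Finsupp.mem_support_iff.2 hne))
      · rw [← hlj, Finsupp.linearCombination_apply, Finsupp.sum_fintype]
        simp
    have hcf : c B (A j) = f := hB.1.eq_of_sum_eq (hc0 B hB _)
      (fun g hg => hfI g fun h => hg (hIB h)) (by rw [hcs B hB, hfs])
    have hjB : j ∉ B := by
      intro hjB
      have h1 : f = Pi.single j 1 := hB.1.eq_of_sum_eq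
        (fun g hg => hfI g fun h => hg (hIB h))
        (fun g hg => by
          rw [Pi.single_apply, if_neg]
          rintro rfl
          exact hg hjB)
        (by rw [hfs]; simp [Pi.single_apply])
      have h2 := hfI j hjI
      rw [h1] at h2
      simp at h2
    have hzero : ∀ g, x g = 0 → ((if g = j then 1 else 0) - c B (A j) g : ℝ) = 0 := by
      intro g hg
      rw [hcf, hfI g fun h => hI h hg, if_neg]
      · simp
      · rintro rfl
        exact hj hg
    have h1 := hkey B hB j hjB 1 fun g hg => by simp [hzero g hg]
    have h2 := hkey B hB j hjB (-1) fun g hg => by simp [hzero g hg]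
    exact hw B hB j hjB (by linarith)
  obtain ⟨B, hSB, hB⟩ := hli.exists_isSimplicialBasis hspan
  have hcx : c B (∑ g, x₀ g • A g) = x := hB.1.eq_of_sum_eq (hc0 B hB _)
    (fun g hg => by
      by_contra hne
      exact hg (hSB hne)) (by rw [hcs B hB, hxs])
  have hpos : ∀ g ∈ B, 0 < x g := fun g hg =>
    lt_of_le_of_ne (hx g) fun h => hgen B hB g hg (by rw [hcx, ← h])
  refine ⟨B, ⟨hB, fun j hj => ?_⟩, fun g hg => hcx ▸ hpos g hg⟩
  have h := hkey B hB j hj 1 fun g hg => by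
    have hgB : g ∉ B := fun h => (hpos g h).ne' hg
    rw [hc0 B hB _ g hgB]
    split_ifs <;> simp
  have h2 := hw B hB j hj
  rw [one_mul] at h
  have := lt_of_le_of_ne h h2.symm
  linarith

lemma optimal_basis_subset {A : ι → E} {c : Finset ι → E →ₗ[ℝ] (ι → ℝ)}
    (hc0 : ∀ B, IsSimplicialBasis A B → ∀ s, ∀ g ∉ B, c B s g = 0)
    (hcs : ∀ B, IsSimplicialBasis A B → ∀ s, ∑ g, c B s g • A g = s)
    (hcu : ∀ B, IsSimplicialBasis A B → ∀ x : ι → ℝ, (∀ g ∉ B, x g = 0) →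
      c B (∑ g, x g • A g) = x)
    {w : ι → ℝ} {B B' : Finset ι} (hB : IsSimplicialBasis A B)
    (hBw : ∀ j ∉ B, ∑ g, c B (A j) g * w g < w j)
    (hB' : IsSimplicialBasis A B') {t : E} (ht' : ∀ g ∈ B', 0 < c B' t g) :
    ∑ g, c B t g * w g ≤ ∑ g, c B' t g * w g ∧
      (∑ g, c B t g * w g = ∑ g, c B' t g * w g → B' ⊆ B) := by
  have hexp : ∑ g, c B t g * w g = ∑ j, c B' t j * ∑ g, c B (A j) g * w g := by
    conv_lhs => rw [← hcs B' hB' t]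
    simp only [map_sum, map_smul, Finset.sum_apply, Pi.smul_apply, smul_eq_mul,
      Finset.sum_mul, Finset.mul_sum]
    rw [Finset.sum_comm]
    simp only [mul_assoc]
  have hcA : ∀ j ∈ B, ∑ g, c B (A j) g * w g = w j := by
    intro j hj
    have h : c B (∑ g, (Pi.single j 1 : ι → ℝ) g • A g) = Pi.single j 1 := hcu B hB _ (by
      intro g hg
      rw [Pi.single_apply, if_neg]
      rintro rfl
      exact hg hj)
    have h2 : ∑ g, (Pi.single j 1 : ι → ℝ) g • A g = A j := by simp [Pi.single_apply]
    rw [h2] at h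
    rw [h]
    simp [Pi.single_apply]
  have hterm : ∀ j, c B' t j * ∑ g, c B (A j) g * w g ≤ c B' t j * w j := by
    intro j
    by_cases hjB : j ∈ B
    · rw [hcA j hjB]
    · by_cases hj' : j ∈ B'
      · exact mul_le_mul_of_nonneg_left (hBw j hjB).le (ht' j hj').le
      · rw [hc0 B' hB' t j hj']; simp
  refine ⟨hexp ▸ Finset.sum_le_sum fun j _ => hterm j, fun heq j hj => ?_⟩
  by_contra hjB
  have : ∑ j, c B' t j * ∑ g, c B (A j) g * w g < ∑ j, c B' t j * w j :=
    Finset.sum_lt_sum (fun j _ => hterm j)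
      ⟨j, Finset.mem_univ j, mul_lt_mul_of_pos_left (hBw j hjB) (ht' j hj)⟩
  rw [← hexp, heq] at this
  exact lt_irrefl _ this

/-- Half-open triangulations: the cone generated by the vectors `A g` is a disjoint union of
half-open simplicial cones.  The half-open cones are those visible from a point of the cone, so
that no face of the form `φ = 0` is removed completely, and one of them can be chosen to contain
a prescribed linearly independent set of generators. -/
theorem exists_halfOpen_triangulation (A : ι → E) (ℓ : E →ₗ[ℝ] ℝ) (hℓ : ∀ g, ℓ (A g) = 1)
    (hspan : Submodule.span ℝ (Set.range A) = ⊤) {S : Set ι} (hS : LinearIndepOn ℝ A S) :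
    ∃ (T : Finset (Finset ι)) (N : Finset ι → Finset ι),
      (∃ B ∈ T, S ⊆ B) ∧
      (∀ B ∈ T, IsSimplicialBasis A B ∧ N B ⊆ B ∧
        ∀ φ : E →ₗ[ℝ] ℝ, (∀ g, 0 ≤ φ (A g)) → (∃ g ∈ B, 0 < φ (A g)) →
          ∃ g ∈ B, g ∉ N B ∧ 0 < φ (A g)) ∧
      ∀ x : ι → ℝ, (∀ g, 0 ≤ x g) → ∃! B, B ∈ T ∧
        ∃ y, IsHalfOpenCoeff B (N B) y ∧ ∑ g, y g • A g = ∑ g, x g • A g := by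
  have hcoords : ∀ B, ∃ c : E →ₗ[ℝ] (ι → ℝ), IsSimplicialBasis A B →
      (∀ s, ∀ g ∉ B, c s g = 0) ∧ (∀ s, ∑ g, c s g • A g = s) ∧
      ∀ x : ι → ℝ, (∀ g ∉ B, x g = 0) → c (∑ g, x g • A g) = x := by
    intro B
    by_cases hB : IsSimplicialBasis A B
    · obtain ⟨c, hc⟩ := hB.exists_coords
      exact ⟨c, fun _ => hc⟩
    · exact ⟨0, fun h => absurd h hB⟩
  choose c hc using hcoords
  have hc0 := fun B hB => (hc B hB).1
  have hcs := fun B hB => (hc B hB).2.1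
  have hcu := fun B hB => (hc B hB).2.2
  obtain ⟨B₀, hSB₀, hB₀⟩ := hS.exists_isSimplicialBasis hspan
  -- generic heights, for which `B₀` is a cell
  obtain ⟨w, hw₀, hw⟩ : ∃ w : ι → ℝ, (∀ j ∉ B₀, ∑ g, c B₀ (A j) g * w g < w j) ∧
      ∀ B, IsSimplicialBasis A B → ∀ j ∉ B, w j - ∑ g, c B (A j) g * w g ≠ 0 := by
    let φ : Finset ι → ι → (ι → ℝ) →ₗ[ℝ] ℝ := fun B j =>
      LinearMap.proj j - ∑ g, c B (A j) g • LinearMap.proj g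
    have hφ : ∀ B j w, φ B j w = w j - ∑ g, c B (A j) g * w g := by
      intro B j w
      simp [φ]
    obtain ⟨w, hwU, hw⟩ := exists_mem_isOpen_forall_ne_zero
      ((fun p : Finset ι × ι => φ p.1 p.2) '' {p | IsSimplicialBasis A p.1 ∧ p.2 ∉ p.1})
      ((Set.toFinite _).image _) (by
        rintro _ ⟨⟨B, j⟩, ⟨hB, hj⟩, rfl⟩ h0
        have h := hφ B j (Pi.single j 1)
        simp only at h0 hB hj
        rw [h0] at h
        simp [Pi.single_apply, hc0 B hB (A j) j hj] at h)
      (U := ⋂ j ∈ (B₀ᶜ : Finset ι), {w | 0 < φ B₀ j w}) (by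
        refine isOpen_biInter_finset fun j _ => ?_
        exact isOpen_lt continuous_const (φ B₀ j).continuous_of_finiteDimensional)
      ⟨fun g => if g ∈ B₀ then 0 else 1, by
        simp only [Set.mem_iInter]
        intro j hj
        rw [Finset.mem_compl] at hj
        simp only [Set.mem_ofPred_eq]
        rw [hφ, if_neg hj, Finset.sum_eq_zero]
        · simp
        · intro g _
          by_cases hg : g ∈ B₀
          · simp [hg]
          · simp [hc0 B₀ hB₀ _ g hg]⟩
    refine ⟨w, fun j hj => ?_, fun B hB j hj => ?_⟩
    · simp only [Set.mem_iInter] at hwU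
      have := hwU j (by simpa using hj)
      simp only [Set.mem_ofPred_eq] at this
      rw [hφ] at this
      linarith
    · rw [← hφ]
      exact hw _ ⟨(B, j), ⟨hB, hj⟩, rfl⟩
  -- a generic point of the cone
  obtain ⟨q, hq0, hq⟩ : ∃ q : ι → ℝ, (∀ g, 0 < q g) ∧
      ∀ B, IsSimplicialBasis A B → ∀ g ∈ B, c B (∑ g, q g • A g) g ≠ 0 := by
    let φ : Finset ι → ι → (ι → ℝ) →ₗ[ℝ] ℝ := fun B j =>
      ∑ g, c B (A g) j • LinearMap.proj g
    have hφ : ∀ B j q, φ B j q = c B (∑ g, q g • A g) j := by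
      intro B j q
      simp [φ, mul_comm]
    obtain ⟨q, hqU, hq⟩ := exists_mem_isOpen_forall_ne_zero
      ((fun p : Finset ι × ι => φ p.1 p.2) '' {p | IsSimplicialBasis A p.1 ∧ p.2 ∈ p.1})
      ((Set.toFinite _).image _) (by
        rintro _ ⟨⟨B, j⟩, ⟨hB, hj⟩, rfl⟩ h0
        have h := hφ B j (Pi.single j 1)
        simp only at h0 hB hj
        rw [h0, hcu B hB (Pi.single j 1)] at h
        · simp at h
        · intro g hg
          rw [Pi.single_apply, if_neg]
          rintro rfl
          exact hg hj)
      (U := ⋂ j, {q | 0 < q j}) (by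
        refine isOpen_iInter_of_finite fun j => ?_
        exact isOpen_lt continuous_const (continuous_apply j))
      ⟨fun _ => 1, by simp⟩
    refine ⟨q, fun j => ?_, fun B hB j hj => ?_⟩
    · simp only [Set.mem_iInter] at hqU
      exact hqU j
    · rw [← hφ]
      exact hq _ ⟨(B, j), ⟨hB, hj⟩, rfl⟩
  generalize hQ : ∑ g, q g • A g = Q at hq
  let T : Finset (Finset ι) := Finset.univ.filter fun B =>
    IsSimplicialBasis A B ∧ ∀ j ∉ B, ∑ g, c B (A j) g * w g < w j
  let N : Finset ι → Finset ι := fun B => B.filter fun g => c B Q g < 0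
  have hT : ∀ B, B ∈ T ↔ IsSimplicialBasis A B ∧ ∀ j ∉ B, ∑ g, c B (A j) g * w g < w j := by
    intro B; simp [T]
  have hN : ∀ B g, g ∈ N B ↔ g ∈ B ∧ c B Q g < 0 := by
    intro B g; simp [N]
  refine ⟨T, N, ⟨B₀, (hT _).2 ⟨hB₀, hw₀⟩, hSB₀⟩, ?_, ?_⟩
  · intro B hBT
    have hB := ((hT B).1 hBT).1
    refine ⟨hB, Finset.filter_subset _ _, fun φ hφ hex => ?_⟩
    by_contra! hall
    obtain ⟨g₀, hg₀, hφg₀⟩ := hex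
    have h1 : 0 ≤ φ Q := by
      rw [← hQ, map_sum]
      exact Finset.sum_nonneg fun g _ => by
        rw [map_smul]
        exact mul_nonneg (hq0 g).le (hφ g)
    have hneg : ∀ g ∈ B, 0 < φ (A g) → c B Q g < 0 := by
      intro g hg hpos
      by_contra hge
      exact absurd (hall g hg fun h => hge ((hN B g).1 h).2) (not_le.2 hpos)
    have h2 : φ Q < 0 := by
      rw [← hcs B hB Q, map_sum]
      have hz : (0 : ℝ) = ∑ _g : ι, (0 : ℝ) := by simp
      rw [hz]
      refine Finset.sum_lt_sum (fun g _ => ?_) ⟨g₀, Finset.mem_univ _, ?_⟩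
      · rw [map_smul, smul_eq_mul]
        by_cases hg : g ∈ B
        · rcases (hφ g).eq_or_lt with h | h
          · rw [← h, mul_zero]
          · exact (mul_neg_of_neg_of_pos (hneg g hg h) h).le
        · rw [hc0 B hB Q g hg, zero_mul]
      · rw [map_smul, smul_eq_mul]
        exact mul_neg_of_neg_of_pos (hneg g₀ hg₀ hφg₀) hφg₀
    linarith
  · intro x hx
    generalize hs : ∑ g, x g • A g = s
    have hev : ∀ᶠ ε in nhdsWithin (0 : ℝ) (Set.Ioi 0), ∀ p : Finset ι × ι,
        (IsSimplicialBasis A p.1 ∧ p.2 ∈ p.1) →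
        (0 < c p.1 s p.2 + ε * c p.1 Q p.2 ↔
          0 ≤ c p.1 s p.2 ∧ (c p.1 Q p.2 < 0 → 0 < c p.1 s p.2)) ∧
        c p.1 s p.2 + ε * c p.1 Q p.2 ≠ 0 := by
      rw [Filter.eventually_all]
      rintro ⟨B, g⟩
      rw [Filter.eventually_imp_distrib_left]
      rintro ⟨hB, hg⟩
      exact eventually_pos_add_mul_iff _ _ (hq B hB g hg)
    obtain ⟨ε, hε, hεpos⟩ := (hev.and self_mem_nhdsWithin).exists
    have hεpos : 0 < ε := hεpos
    have hmem : ∀ B, IsSimplicialBasis A B →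
        ((∃ y, IsHalfOpenCoeff B (N B) y ∧ ∑ g, y g • A g = s) ↔
          ∀ g ∈ B, 0 < c B (s + ε • Q) g) := by
      intro B hB
      have hrw : ∀ g, c B (s + ε • Q) g = c B s g + ε * c B Q g := by simp
      constructor
      · rintro ⟨y, ⟨hy0, hy1, hy2⟩, hys⟩ g hg
        rw [hrw, (hε (B, g) ⟨hB, hg⟩).1]
        have : c B s = y := by rw [← hys]; exact hcu B hB y hy0
        simp only [this]
        exact ⟨hy1 g, fun h => hy2 g ((hN B g).2 ⟨hg, h⟩)⟩
      · intro h
        have h' : ∀ g ∈ B, 0 ≤ c B s g ∧ (c B Q g < 0 → 0 < c B s g) := by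
          intro g hg
          have := h g hg
          rwa [hrw, (hε (B, g) ⟨hB, hg⟩).1] at this
        refine ⟨c B s, ⟨hc0 B hB s, fun g => ?_, fun g hg => ?_⟩, hcs B hB s⟩
        · by_cases hg : g ∈ B
          · exact (h' g hg).1
          · rw [hc0 B hB s g hg]
        · rw [hN] at hg
          exact (h' g hg.1).2 hg.2
    have hsum : ∑ g, (x g + ε * q g) • A g = s + ε • Q := by
      simp only [add_smul, mul_smul, Finset.sum_add_distrib, ← Finset.smul_sum, hs, hQ]
    obtain ⟨B, hBT, hBpos⟩ := exists_optimal_basis hℓ hspan hc0 hcs hw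
      (x₀ := fun g => x g + ε * q g)
      (fun g => add_nonneg (hx g) (mul_nonneg hεpos.le (hq0 g).le)) (by
        intro B hB g hg
        rw [hsum]
        simpa using (hε (B, g) ⟨hB, hg⟩).2)
    rw [hsum] at hBpos
    refine ⟨B, ⟨(hT B).2 hBT, (hmem B hBT.1).2 hBpos⟩, ?_⟩
    rintro B' ⟨hB'T, hB'⟩
    rw [hT] at hB'T
    rw [hmem B' hB'T.1] at hB'
    obtain ⟨le1, eq1⟩ := optimal_basis_subset hc0 hcs hcu hBT.1 hBT.2 hB'T.1 hB'
    obtain ⟨le2, eq2⟩ := optimal_basis_subset hc0 hcs hcu hB'T.1 hB'T.2 hBT.1 hBpos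
    have heq := le_antisymm le1 le2
    exact (eq1 heq).antisymm (eq2 heq.symm)

end HalfOpenTriangulation

section LatticePointsInCones

variable {ι : Type*} [Fintype ι] {k d : ℕ}

/-- The generator of the Cayley cone given by a lattice point `pt g` of the polytope with
index `col g`. -/
def cayleyVector (col : ι → Fin k) (pt : ι → Fin d → ℤ) (g : ι) :
    (Fin k → ℝ) × (Fin d → ℝ) :=
  (Pi.single (col g) 1, fun i => (pt g i : ℝ))

/-- The embedding of the integer lattice. -/
def latticeCast (b : Fin k → ℤ) (z : Fin d → ℤ) : (Fin k → ℝ) × (Fin d → ℝ) :=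
  (fun i => (b i : ℝ), fun i => (z i : ℝ))

lemma latticeCast_inj {b b' : Fin k → ℤ} {z z' : Fin d → ℤ} :
    latticeCast b z = latticeCast b' z' ↔ b = b' ∧ z = z' := by
  simp [latticeCast, Prod.ext_iff, funext_iff]

lemma sum_smul_cayleyVector_fst (col : ι → Fin k) (pt : ι → Fin d → ℤ) (x : ι → ℝ) (i : Fin k) :
    (∑ g, x g • cayleyVector col pt g).1 i = ∑ g with col g = i, x g := by
  simp only [Prod.fst_sum, Finset.sum_apply, Prod.smul_fst, Pi.smul_apply, cayleyVector,
    Pi.single_apply, smul_eq_mul, mul_ite, mul_one, mul_zero, Finset.sum_filter, eq_comm]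

lemma sum_smul_cayleyVector_snd (col : ι → Fin k) (pt : ι → Fin d → ℤ) (x : ι → ℝ) (i : Fin d) :
    (∑ g, x g • cayleyVector col pt g).2 i = ∑ g, x g * pt g i := by
  simp [Prod.snd_sum, cayleyVector]

lemma sum_natCast_smul_cayleyVector (col : ι → Fin k) (pt : ι → Fin d → ℤ) (c : ι → ℤ) :
    ∑ g, (c g : ℝ) • cayleyVector col pt g =
      latticeCast (fun i => ∑ g with col g = i, c g) (fun i => ∑ g, c g * pt g i) := by
  ext i
  · rw [sum_smul_cayleyVector_fst]; simp [latticeCast]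
  · rw [sum_smul_cayleyVector_snd]; simp [latticeCast]

/-- Stars and bars, colour by colour. -/
lemma exists_finset_colored_compositions (col : ι → Fin k) (B : Finset ι) (m β : Fin k → ℕ)
    (hβ : ∀ i, β i < (B.filter fun g => col g = i).card) :
    ∃ C : Finset (ι → ℕ), (∀ c, c ∈ C ↔ (∀ g ∉ B, c g = 0) ∧
        ∀ i, ∑ g with col g = i, c g + β i = m i) ∧
      C.card = ∏ i, (m i + (B.filter fun g => col g = i).card - 1 - β i).choose
        ((B.filter fun g => col g = i).card - 1) := by
  by_cases hm : ∀ i, β i ≤ m i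
  · let D : Fin k → Finset (ι →₀ ℕ) := fun i =>
      (B.filter fun g => col g = i).finsuppAntidiag (m i - β i)
    have hD : ∀ i f, f ∈ D i ↔ (∑ g ∈ B.filter fun g => col g = i, f g = m i - β i) ∧
        ∀ g, ¬ (g ∈ B ∧ col g = i) → f g = 0 := by
      intro i f
      simp only [D, Finset.mem_finsuppAntidiag, Finset.subset_iff, Finsupp.mem_support_iff,
        Finset.mem_filter]
      exact and_congr_right fun _ => forall_congr' fun g => not_imp_comm
    have hrestrict : ∀ c : ι → ℕ, (∀ g ∉ B, c g = 0) → ∀ i,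
        ∑ g ∈ B.filter (fun g => col g = i), c g = ∑ g with col g = i, c g := by
      intro c hc i
      refine Finset.sum_subset (Finset.filter_subset_filter _ (Finset.subset_univ B)) ?_
      intro g hg hg'
      simp only [Finset.mem_filter, Finset.mem_univ, true_and] at hg hg'
      exact hc g fun h => hg' ⟨h, hg⟩
    refine ⟨(Fintype.piFinset D).image fun G g => G (col g) g, ?_, ?_⟩
    · intro c
      simp only [Finset.mem_image, Fintype.mem_piFinset]
      constructor
      · rintro ⟨G, hG, rfl⟩
        have h0 : ∀ g ∉ B, G (col g) g = 0 := fun g hg =>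
          ((hD _ _).1 (hG (col g))).2 g fun h => hg h.1
        refine ⟨h0, fun i => ?_⟩
        have h1 := ((hD _ _).1 (hG i)).1
        rw [← hrestrict (fun g => G (col g) g) h0 i]
        have h2 : ∑ g ∈ B.filter (fun g => col g = i), G (col g) g =
            ∑ g ∈ B.filter (fun g => col g = i), G i g := by
          refine Finset.sum_congr rfl fun g hg => ?_
          rw [(Finset.mem_filter.1 hg).2]
        rw [h2, h1]
        exact Nat.sub_add_cancel (hm i)
      · rintro ⟨hc0, hc⟩
        refine ⟨fun i => Finsupp.equivFunOnFinite.symm fun g => if col g = i then c g else 0,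
          fun i => (hD _ _).2 ⟨?_, ?_⟩, ?_⟩
        · have h2 : ∑ g ∈ B.filter (fun g => col g = i), (if col g = i then c g else 0) =
            ∑ g ∈ B.filter (fun g => col g = i), c g := by
            refine Finset.sum_congr rfl fun g hg => ?_
            rw [if_pos (Finset.mem_filter.1 hg).2]
          have h3 := hc i
          simp only [Finsupp.equivFunOnFinite_symm_apply_apply]
          rw [h2, hrestrict c hc0]
          omega
        · intro g hg
          simp only [Finsupp.equivFunOnFinite_symm_apply_apply]
          split_ifs with h
          · exact hc0 g fun h' => hg ⟨h', h⟩
          · rfl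
        · ext g; simp
    · rw [Finset.card_image_of_injOn, Fintype.card_piFinset]
      · refine Finset.prod_congr rfl fun i _ => ?_
        have h1 := hβ i
        have h2 := hm i
        simp only [D]
        rw [Finset.card_finsuppAntidiag_nat_eq_choose]
        generalize (B.filter fun g => col g = i).card = s at *
        rw [show m i + s - 1 - β i = s + (m i - β i) - 1 by omega]
        exact Nat.choose_symm_of_eq_add (by omega)
      · intro G hG G' hG' heq
        simp only [Finset.mem_coe, Fintype.mem_piFinset] at hG hG'
        ext i g
        by_cases hgi : g ∈ B ∧ col g = i
        · have := congrFun heq g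
          simp only [hgi.2] at this
          exact this
        · rw [((hD _ _).1 (hG i)).2 g hgi, ((hD _ _).1 (hG' i)).2 g hgi]
  · push Not at hm
    obtain ⟨i, hi⟩ := hm
    refine ⟨∅, fun c => ⟨fun h => by simp at h, fun h => ?_⟩, ?_⟩
    · have := h.2 i
      omega
    · have h1 := hβ i
      rw [Finset.card_empty, eq_comm, Finset.prod_eq_zero (Finset.mem_univ i)]
      exact Nat.choose_eq_zero_of_lt (by omega)

/-- The coefficient vectors of lattice points in the half-open fundamental parallelepiped. -/
def fundamentalCoeffs (col : ι → Fin k) (pt : ι → Fin d → ℤ) (B N : Finset ι) : Set (ι → ℝ) :=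
  {f | (∀ g ∉ B, f g = 0) ∧ (∀ g ∈ N, 0 < f g ∧ f g ≤ 1) ∧ (∀ g ∉ N, 0 ≤ f g ∧ f g < 1) ∧
    ∃ b z, ∑ g, f g • cayleyVector col pt g = latticeCast b z}

lemma fundamentalCoeffs.mem_Icc {col : ι → Fin k} {pt : ι → Fin d → ℤ} {B N : Finset ι}
    {f : ι → ℝ} (hf : f ∈ fundamentalCoeffs col pt B N) (g : ι) : 0 ≤ f g ∧ f g ≤ 1 := by
  by_cases hg : g ∈ N
  · exact ⟨(hf.2.1 g hg).1.le, (hf.2.1 g hg).2⟩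
  · exact ⟨(hf.2.2.1 g hg).1, (hf.2.2.1 g hg).2.le⟩

lemma finite_fundamentalCoeffs {col : ι → Fin k} {pt : ι → Fin d → ℤ} {B N : Finset ι}
    (hB : LinearIndepOn ℝ (cayleyVector col pt) (B : Set ι)) :
    (fundamentalCoeffs col pt B N).Finite := by
  have hfin : (((Set.Icc (fun _ => 0) (fun _ => (Fintype.card ι : ℤ)) : Set (Fin k → ℤ)) ×ˢ
      (Set.Icc (fun i => -∑ g, |pt g i|) (fun i => ∑ g, |pt g i|) : Set (Fin d → ℤ))).image
        fun p => latticeCast p.1 p.2).Finite :=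
    ((Set.finite_Icc _ _).prod (Set.finite_Icc _ _)).image _
  refine Set.Finite.of_finite_image (f := fun f => ∑ g, f g • cayleyVector col pt g)
    (hfin.subset ?_) ?_
  · rintro _ ⟨f, hf, rfl⟩
    obtain ⟨b, z, hbz⟩ := hf.2.2.2
    have hf01 := fundamentalCoeffs.mem_Icc hf
    refine ⟨(b, z), ⟨?_, ?_⟩, hbz.symm⟩
    · have hb : ∀ i, (b i : ℝ) = ∑ g with col g = i, f g := by
        intro i
        rw [← sum_smul_cayleyVector_fst col pt, hbz]; rfl
      constructor
      · intro i
        have : (0 : ℝ) ≤ b i := by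
          rw [hb]; exact Finset.sum_nonneg fun g _ => (hf01 g).1
        exact_mod_cast this
      · intro i
        have : (b i : ℝ) ≤ Fintype.card ι := by
          rw [hb]
          calc ∑ g with col g = i, f g ≤ ∑ g, f g :=
                Finset.sum_le_sum_of_subset_of_nonneg (Finset.subset_univ _)
                  fun g _ _ => (hf01 g).1
            _ ≤ ∑ _g : ι, (1 : ℝ) := Finset.sum_le_sum fun g _ => (hf01 g).2
            _ = Fintype.card ι := by simp
        exact_mod_cast this
    · have hz : ∀ i, (z i : ℝ) = ∑ g, f g * pt g i := by
        intro i
        rw [← sum_smul_cayleyVector_snd col pt, hbz]; rfl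
      have habs : ∀ i, |z i| ≤ ∑ g, |pt g i| := by
        intro i
        have : |(z i : ℝ)| ≤ ∑ g, |(pt g i : ℝ)| := by
          rw [hz]
          refine (Finset.abs_sum_le_sum_abs _ _).trans (Finset.sum_le_sum fun g _ => ?_)
          rw [abs_mul, abs_of_nonneg (hf01 g).1]
          exact mul_le_of_le_one_left (abs_nonneg _) (hf01 g).2
        exact_mod_cast this
      exact ⟨fun i => (abs_le.1 (habs i)).1, fun i => (abs_le.1 (habs i)).2⟩
  · intro f hf f' hf' heq
    exact hB.eq_of_sum_eq hf.1 hf'.1 heq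

/-- Multigraded count of the lattice points in a half-open simplicial Cayley cone. -/
lemma exists_count_halfOpen_cone (col : ι → Fin k) (pt : ι → Fin d → ℤ) {B N : Finset ι}
    (hB : LinearIndepOn ℝ (cayleyVector col pt) (B : Set ι)) (hNB : N ⊆ B)
    (hcol : ∀ i, ∃ g ∈ B, g ∉ N ∧ col g = i) :
    ∃ (F : Finset (ι → ℝ)) (β : (ι → ℝ) → Fin k → ℕ), F.Nonempty ∧
      (∀ f ∈ F, ∀ i, β f i < (B.filter fun g => col g = i).card) ∧
      ∀ m : Fin k → ℕ, ∃ Z : Finset (Fin d → ℤ),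
        (∀ z, z ∈ Z ↔ ∃ x, IsHalfOpenCoeff B N x ∧
          ∑ g, x g • cayleyVector col pt g = latticeCast (fun i => (m i : ℤ)) z) ∧
        Z.card = ∑ f ∈ F, ∏ i, (m i + (B.filter fun g => col g = i).card - 1 - β f i).choose
          ((B.filter fun g => col g = i).card - 1) := by
  let β : (ι → ℝ) → Fin k → ℕ := fun f i => ⌊∑ g with col g = i, f g⌋₊
  have hfin := finite_fundamentalCoeffs (N := N) hB
  have hβ : ∀ f ∈ fundamentalCoeffs col pt B N, ∀ i, (β f i : ℝ) = ∑ g with col g = i, f g := by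
    intro f hf i
    obtain ⟨b, z, hbz⟩ := hf.2.2.2
    have hb : ∑ g with col g = i, f g = (b i : ℝ) := by
      rw [← sum_smul_cayleyVector_fst col pt, hbz]; rfl
    have hb0 : (0 : ℝ) ≤ b i := by
      rw [← hb]; exact Finset.sum_nonneg fun g _ => (fundamentalCoeffs.mem_Icc hf g).1
    have hb1 : 0 ≤ b i := by exact_mod_cast hb0
    obtain ⟨n, hn⟩ := Int.eq_ofNat_of_zero_le hb1
    simp only [β]
    rw [hb, hn]
    simp
  have hβlt : ∀ f ∈ fundamentalCoeffs col pt B N, ∀ i,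
      β f i < (B.filter fun g => col g = i).card := by
    intro f hf i
    have h1 : (β f i : ℝ) < (B.filter fun g => col g = i).card := by
      rw [hβ f hf i]
      have h2 : ∑ g with col g = i, f g = ∑ g ∈ B.filter (fun g => col g = i), f g := by
        refine (Finset.sum_subset (Finset.filter_subset_filter _ (Finset.subset_univ B)) ?_).symm
        intro g hg hg'
        simp only [Finset.mem_filter, Finset.mem_univ, true_and] at hg hg'
        exact hf.1 g fun h => hg' ⟨h, hg⟩
      rw [h2, Finset.card_eq_sum_ones]
      push_cast
      obtain ⟨g, hgB, hgN, hgi⟩ := hcol i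
      exact Finset.sum_lt_sum (fun g _ => (fundamentalCoeffs.mem_Icc hf g).2)
        ⟨g, Finset.mem_filter.2 ⟨hgB, hgi⟩, (hf.2.2.1 g hgN).2⟩
    exact_mod_cast h1
  refine ⟨hfin.toFinset, β, ?_, fun f hf => hβlt f (by simpa using hf), fun m => ?_⟩
  · refine ⟨fun g => if g ∈ N then 1 else 0, ?_⟩
    rw [Set.Finite.mem_toFinset]
    refine ⟨fun g hg => if_neg fun h => hg (hNB h), fun g hg => by simp [hg],
      fun g hg => by simp [hg], ?_⟩
    have h := sum_natCast_smul_cayleyVector col pt fun g => if g ∈ N then 1 else 0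
    push_cast at h
    exact ⟨_, _, h⟩
  have hC : ∀ f, ∃ C : Finset (ι → ℕ), f ∈ hfin.toFinset →
      (∀ c, c ∈ C ↔ (∀ g ∉ B, c g = 0) ∧ ∀ i, ∑ g with col g = i, c g + β f i = m i) ∧
      C.card = ∏ i, (m i + (B.filter fun g => col g = i).card - 1 - β f i).choose
        ((B.filter fun g => col g = i).card - 1) := by
    intro f
    by_cases hf : f ∈ hfin.toFinset
    · obtain ⟨C, hC⟩ := exists_finset_colored_compositions col B m (β f)
        (hβlt f (by simpa using hf))
      exact ⟨C, fun _ => hC⟩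
    · exact ⟨∅, fun h => absurd h hf⟩
  choose C hC using hC
  let u : (_ : ι → ℝ) × (ι → ℕ) → (Fin k → ℝ) × (Fin d → ℝ) := fun p =>
    ∑ g, (p.1 g + p.2 g) • cayleyVector col pt g
  have himage : {v | ∃ x, IsHalfOpenCoeff B N x ∧ ∑ g, x g • cayleyVector col pt g = v ∧
      ∃ z, v = latticeCast (fun i => (m i : ℤ)) z} = ↑((hfin.toFinset.sigma C).image u) := by
    ext v
    simp only [Set.mem_ofPred_eq, Finset.coe_image, Set.mem_image, Finset.mem_coe,
      Finset.mem_sigma]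
    constructor
    · rintro ⟨x, ⟨hx0, hx1, hx2⟩, hxv, z, hvz⟩
      let c : ι → ℕ := fun g => if g ∈ N then ⌈x g⌉₊ - 1 else ⌊x g⌋₊
      have hc0 : ∀ g ∉ B, c g = 0 := by
        intro g hg
        simp [c, hx0 g hg]
      have hcN : ∀ g ∈ N, 0 < x g - c g ∧ x g - c g ≤ 1 := by
        intro g hg
        have h1 := Nat.ceil_lt_add_one (hx1 g)
        have h2 := Nat.le_ceil (x g)
        have h3 := Nat.ceil_pos.2 (hx2 g hg)
        simp only [c, if_pos hg]
        rw [Nat.cast_sub (by omega)]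
        push_cast
        constructor <;> linarith
      have hcN' : ∀ g ∉ N, 0 ≤ x g - c g ∧ x g - c g < 1 := by
        intro g hg
        have h1 := Nat.lt_floor_add_one (x g)
        have h2 := Nat.floor_le (hx1 g)
        simp only [c, if_neg hg]
        constructor <;> linarith
      have hsplit : ∑ g, (x g - c g) • cayleyVector col pt g =
          latticeCast (fun i => (m i : ℤ) - ∑ g with col g = i, (c g : ℤ))
            (fun i => z i - ∑ g, (c g : ℤ) * pt g i) := by
        have h := sum_natCast_smul_cayleyVector col pt fun g => (c g : ℤ)
        simp only [sub_smul, Finset.sum_sub_distrib, hxv, hvz]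
        simp only [Int.cast_natCast] at h
        rw [h]
        ext i <;> simp [latticeCast]
      have hf : (fun g => x g - c g) ∈ fundamentalCoeffs col pt B N :=
        ⟨fun g hg => by simp [hx0 g hg, hc0 g hg], hcN, hcN', _, _, hsplit⟩
      refine ⟨⟨fun g => x g - c g, c⟩, ⟨by simpa using hf, ?_⟩, ?_⟩
      · refine ((hC _ (by simpa using hf)).1 _).2 ⟨hc0, fun i => ?_⟩
        have h1 := hβ _ hf i
        have h2 : ∑ g with col g = i, x g = (m i : ℝ) := by
          rw [← sum_smul_cayleyVector_fst col pt, hxv, hvz]; simp [latticeCast]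
        rw [Finset.sum_sub_distrib, h2] at h1
        have h3 : ((∑ g with col g = i, c g + β (fun g => x g - c g) i : ℕ) : ℝ) = m i := by
          push_cast
          linarith
        exact_mod_cast h3
      · simp only [u, sub_add_cancel]
        exact hxv
    · rintro ⟨⟨f, c⟩, ⟨hf, hc⟩, rfl⟩
      have hf' : f ∈ fundamentalCoeffs col pt B N := by simpa using hf
      obtain ⟨hc0, hc⟩ := ((hC f hf).1 c).1 hc
      refine ⟨fun g => f g + c g, ⟨fun g hg => by simp [hf'.1 g hg, hc0 g hg], fun g => ?_,
        fun g hg => ?_⟩, rfl, ?_⟩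
      · have := (fundamentalCoeffs.mem_Icc hf' g).1
        positivity
      · have := (hf'.2.1 g hg).1
        positivity
      · obtain ⟨b, z, hbz⟩ := hf'.2.2.2
        refine ⟨fun i => z i + ∑ g, (c g : ℤ) * pt g i, ?_⟩
        have h := sum_natCast_smul_cayleyVector col pt fun g => (c g : ℤ)
        simp only [Int.cast_natCast] at h
        simp only [u, add_smul, Finset.sum_add_distrib]
        ext i
        · have h1 := hβ f hf' i
          rw [Prod.fst_add, Pi.add_apply, sum_smul_cayleyVector_fst, sum_smul_cayleyVector_fst,
            ← h1]
          have h2 : ((∑ g with col g = i, c g + β f i : ℕ) : ℝ) = m i := by rw [hc i]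
          push_cast at h2
          simp only [latticeCast, Int.cast_natCast]
          linarith
        · rw [h, hbz]; simp [latticeCast]
  have huinj : Set.InjOn u ↑(hfin.toFinset.sigma C) := by
    rintro ⟨f, c⟩ hfc ⟨f', c'⟩ hfc' heq
    simp only [Finset.coe_sigma, Set.mem_sigma_iff, Finset.mem_coe] at hfc hfc'
    have hf : f ∈ fundamentalCoeffs col pt B N := by simpa using hfc.1
    have hf' : f' ∈ fundamentalCoeffs col pt B N := by simpa using hfc'.1
    have hc := ((hC f hfc.1).1 c).1 hfc.2
    have hc' := ((hC f' hfc'.1).1 c').1 hfc'.2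
    have hsum := hB.eq_of_sum_eq (x := fun g => f g + c g) (y := fun g => f' g + c' g)
      (fun g hg => by simp [hf.1 g hg, hc.1 g hg]) (fun g hg => by simp [hf'.1 g hg, hc'.1 g hg])
      heq
    have hcc : c = c' := by
      ext g
      have hg := congrFun hsum g
      have hlt : ((c g : ℤ) : ℝ) < (c' g : ℤ) + 1 ∧ ((c' g : ℤ) : ℝ) < (c g : ℤ) + 1 := by
        push_cast
        by_cases hgN : g ∈ N
        · have h1 := hf.2.1 g hgN
          have h2 := hf'.2.1 g hgN
          constructor <;> linarith
        · have h1 := hf.2.2.1 g hgN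
          have h2 := hf'.2.2.1 g hgN
          constructor <;> linarith
      have h1 : (c g : ℤ) < c' g + 1 := by exact_mod_cast hlt.1
      have h2 : (c' g : ℤ) < c g + 1 := by exact_mod_cast hlt.2
      omega
    subst hcc
    have hff : f = f' := by
      ext g
      have hg := congrFun hsum g
      simpa using hg
    subst hff
    rfl
  let S : Set (Fin d → ℤ) := {z | ∃ x, IsHalfOpenCoeff B N x ∧
    ∑ g, x g • cayleyVector col pt g = latticeCast (fun i => (m i : ℤ)) z}
  have hinj : Function.Injective fun z : Fin d → ℤ => latticeCast (fun i => (m i : ℤ)) z :=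
    fun z z' h => (latticeCast_inj.1 h).2
  have hS : (fun z : Fin d → ℤ => latticeCast (fun i => (m i : ℤ)) z) '' S =
      ↑((hfin.toFinset.sigma C).image u) := by
    rw [← himage]
    ext v
    constructor
    · rintro ⟨z, ⟨x, hx, hxz⟩, rfl⟩
      exact ⟨x, hx, hxz, z, rfl⟩
    · rintro ⟨x, hx, hxv, z, hvz⟩
      exact ⟨z, ⟨x, hx, hxv.trans hvz⟩, hvz.symm⟩
  have hSfin : S.Finite := by
    refine Set.Finite.of_finite_image ?_ hinj.injOn
    rw [hS]
    exact Finset.finite_toSet _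
  refine ⟨hSfin.toFinset, fun z => by simp [S], ?_⟩
  rw [← Set.ncard_eq_toFinset_card S hSfin, ← Set.ncard_image_of_injective S hinj, hS,
    Set.ncard_coe_finset, Finset.card_image_of_injOn huinj, Finset.card_sigma]
  exact Finset.sum_congr rfl fun f hf => (hC f hf).2

end LatticePointsInCones

section CayleyCount

variable {ι : Type*} {k d : ℕ}

lemma IsSimplicialBasis.card_eq_finrank {E : Type*} [NormedAddCommGroup E] [NormedSpace ℝ E]
    {A : ι → E} {B : Finset ι} (hB : IsSimplicialBasis A B) : B.card = Module.finrank ℝ E := by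
  have hspan : ⊤ ≤ Submodule.span ℝ (Set.range fun g : (B : Set ι) => A g) := by
    rw [← Set.image_eq_range, hB.2]
  rw [Module.finrank_eq_card_basis (Module.Basis.mk hB.1 hspan)]
  simp

lemma IsSimplicialBasis.sum_card_color {col : ι → Fin k} {pt : ι → Fin d → ℤ} {B : Finset ι}
    (hB : IsSimplicialBasis (cayleyVector col pt) B) :
    ∑ i, (B.filter fun g => col g = i).card = k + d := by
  rw [← Finset.card_eq_sum_card_fiberwise fun g _ => Finset.mem_univ (col g),
    hB.card_eq_finrank]
  simp

/-- The functional on the Cayley space reading off the multiplicity of the colour `i`. -/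
def colorFunctional (k d : ℕ) (i : Fin k) : (Fin k → ℝ) × (Fin d → ℝ) →ₗ[ℝ] ℝ :=
  LinearMap.proj i ∘ₗ LinearMap.fst ℝ (Fin k → ℝ) (Fin d → ℝ)

lemma colorFunctional_cayleyVector (col : ι → Fin k) (pt : ι → Fin d → ℤ) (i : Fin k) (g : ι) :
    colorFunctional k d i (cayleyVector col pt g) = if col g = i then 1 else 0 := by
  simp [colorFunctional, cayleyVector, Pi.single_apply, eq_comm]

lemma IsSimplicialBasis.exists_color_eq {col : ι → Fin k} {pt : ι → Fin d → ℤ} {B : Finset ι}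
    (hB : IsSimplicialBasis (cayleyVector col pt) B) (i : Fin k) : ∃ g ∈ B, col g = i := by
  by_contra! h
  have h0 : colorFunctional k d i = 0 := by
    refine LinearMap.ext_on_range (v := fun g : (B : Set ι) => cayleyVector col pt g) ?_ ?_
    · rw [← Set.image_eq_range, hB.2]
    · intro g
      simp [colorFunctional_cayleyVector, h g g.2]
  have h1 := LinearMap.congr_fun h0 (Pi.single i 1, 0)
  simp [colorFunctional] at h1

/-- The multigraded lattice point count of a Cayley cone is a nonnegative combination of products
of binomial coefficients. -/
theorem exists_count_cayley_cone [Fintype ι] (col : ι → Fin k) (pt : ι → Fin d → ℤ)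
    (hspan : Submodule.span ℝ (Set.range (cayleyVector col pt)) = ⊤) {S : Set ι}
    (hS : LinearIndepOn ℝ (cayleyVector col pt) S) :
    ∃ (T : Finset (Finset ι)) (F : Finset ι → Finset (ι → ℝ))
      (β : Finset ι → (ι → ℝ) → Fin k → ℕ), (∃ B ∈ T, S ⊆ B) ∧
      (∀ B ∈ T, (F B).Nonempty ∧ (∀ i, 0 < (B.filter fun g => col g = i).card) ∧
        ∑ i, (B.filter fun g => col g = i).card = k + d ∧
        ∀ f ∈ F B, ∀ i, β B f i < (B.filter fun g => col g = i).card) ∧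
      ∀ m : Fin k → ℕ, Set.ncard {z | ∃ x : ι → ℝ, (∀ g, 0 ≤ x g) ∧
          ∑ g, x g • cayleyVector col pt g = latticeCast (fun i => (m i : ℤ)) z} =
        ∑ B ∈ T, ∑ f ∈ F B, ∏ i, (m i + (B.filter fun g => col g = i).card - 1 - β B f i).choose
          ((B.filter fun g => col g = i).card - 1) := by
  obtain ⟨T, N, hST, hT, hcover⟩ := exists_halfOpen_triangulation (cayleyVector col pt)
    (∑ i, colorFunctional k d i)
    (fun g => by simp [LinearMap.sum_apply, colorFunctional_cayleyVector]) hspan hS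
  have hcol : ∀ B ∈ T, ∀ i, ∃ g ∈ B, g ∉ N B ∧ col g = i := by
    intro B hB i
    obtain ⟨g, hg, hgi⟩ := (hT B hB).1.exists_color_eq i
    obtain ⟨g', h1, h2, h3⟩ := (hT B hB).2.2 (colorFunctional k d i)
      (fun g => by rw [colorFunctional_cayleyVector]; split_ifs <;> norm_num)
      ⟨g, hg, by simp [colorFunctional_cayleyVector, hgi]⟩
    refine ⟨g', h1, h2, ?_⟩
    by_contra hne
    simp [colorFunctional_cayleyVector, hne] at h3
  have hcount : ∀ B, ∃ (F : Finset (ι → ℝ)) (β : (ι → ℝ) → Fin k → ℕ), B ∈ T → F.Nonempty ∧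
      (∀ f ∈ F, ∀ i, β f i < (B.filter fun g => col g = i).card) ∧
      ∀ m : Fin k → ℕ, ∃ Z : Finset (Fin d → ℤ),
        (∀ z, z ∈ Z ↔ ∃ x, IsHalfOpenCoeff B (N B) x ∧
          ∑ g, x g • cayleyVector col pt g = latticeCast (fun i => (m i : ℤ)) z) ∧
        Z.card = ∑ f ∈ F, ∏ i, (m i + (B.filter fun g => col g = i).card - 1 - β f i).choose
          ((B.filter fun g => col g = i).card - 1) := by
    intro B
    by_cases hB : B ∈ T
    · obtain ⟨F, β, h⟩ := exists_count_halfOpen_cone col pt (hT B hB).1.1 (hT B hB).2.1 (hcol B hB)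
      exact ⟨F, β, fun _ => h⟩
    · exact ⟨∅, fun _ _ => 0, fun h => absurd h hB⟩
  choose F β hcount using hcount
  refine ⟨T, F, β, hST, fun B hB => ⟨(hcount B hB).1, fun i => ?_,
    (hT B hB).1.sum_card_color, (hcount B hB).2.1⟩, fun m => ?_⟩
  · obtain ⟨g, hg, hgi⟩ := (hT B hB).1.exists_color_eq i
    exact Finset.card_pos.2 ⟨g, Finset.mem_filter.2 ⟨hg, hgi⟩⟩
  have hZ : ∀ B, ∃ Z : Finset (Fin d → ℤ), B ∈ T →
        (∀ z, z ∈ Z ↔ ∃ x, IsHalfOpenCoeff B (N B) x ∧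
          ∑ g, x g • cayleyVector col pt g = latticeCast (fun i => (m i : ℤ)) z) ∧
        Z.card = ∑ f ∈ F B, ∏ i, (m i + (B.filter fun g => col g = i).card - 1 - β B f i).choose
          ((B.filter fun g => col g = i).card - 1) := by
    intro B
    by_cases hB : B ∈ T
    · obtain ⟨Z, h⟩ := (hcount B hB).2.2 m
      exact ⟨Z, fun _ => h⟩
    · exact ⟨∅, fun h => absurd h hB⟩
  choose Z hZ using hZ
  have hunion : {z | ∃ x : ι → ℝ, (∀ g, 0 ≤ x g) ∧
      ∑ g, x g • cayleyVector col pt g = latticeCast (fun i => (m i : ℤ)) z} =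
      ↑(T.biUnion Z) := by
    ext z
    simp only [Set.mem_ofPred_eq, Finset.mem_coe, Finset.mem_biUnion]
    constructor
    · rintro ⟨x, hx, hxz⟩
      obtain ⟨B, ⟨hB, y, hy, hyx⟩, -⟩ := hcover x hx
      exact ⟨B, hB, ((hZ B hB).1 z).2 ⟨y, hy, hyx.trans hxz⟩⟩
    · rintro ⟨B, hB, hz⟩
      obtain ⟨x, hx, hxz⟩ := ((hZ B hB).1 z).1 hz
      exact ⟨x, hx.2.1, hxz⟩
  rw [hunion, Set.ncard_coe_finset, Finset.card_biUnion]
  · exact Finset.sum_congr rfl fun B hB => (hZ B hB).2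
  · intro B hB B' hB' hne
    refine Finset.disjoint_left.2 fun z hz hz' => hne ?_
    obtain ⟨x, hx, hxz⟩ := ((hZ B hB).1 z).1 hz
    obtain ⟨x', hx', hxz'⟩ := ((hZ B' hB').1 z).1 hz'
    exact (hcover x hx.2.1).unique ⟨hB, x, hx, rfl⟩ ⟨hB', x', hx', hxz'.trans hxz.symm⟩

end CayleyCount

section CayleyGeometry

variable {k d : ℕ}

lemma mem_smul_convexHull_iff {E : Type*} [AddCommGroup E] [Module ℝ E] {α : Type*}
    {V : Finset α} (hV : V.Nonempty) (p : α → E) {t : ℝ} (ht : 0 ≤ t) (y : E) :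
    y ∈ t • convexHull ℝ (p '' V) ↔
      ∃ w : V → ℝ, (∀ a, 0 ≤ w a) ∧ ∑ a, w a = t ∧ ∑ a, w a • p a = y := by
  rw [Set.image_eq_range]
  constructor
  · rintro ⟨q, hq, rfl⟩
    rw [convexHull_range_eq_exists_affineCombination] at hq
    obtain ⟨s, w, hw0, hw1, rfl⟩ := hq
    refine ⟨fun a => if a ∈ s then t * w a else 0, fun a => ?_, ?_, ?_⟩
    · dsimp only
      split_ifs with h
      · exact mul_nonneg ht (hw0 a h)
      · exact le_rfl
    · simp [← Finset.mul_sum, hw1, -Finset.univ_eq_attach]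
    · simp [-Finset.univ_eq_attach, s.affineCombination_eq_linear_combination _ _ hw1,
        Finset.smul_sum, smul_smul, ite_smul]
  · rintro ⟨w, hw0, hw1, rfl⟩
    rcases ht.eq_or_lt with ht' | ht'
    · rw [← ht', Finset.sum_eq_zero_iff_of_nonneg fun a _ => hw0 a] at hw1
      obtain ⟨a, ha⟩ := hV
      refine ⟨p a, subset_convexHull ℝ _ ⟨⟨a, ha⟩, rfl⟩, ?_⟩
      simp [← ht', fun a => hw1 a (Finset.mem_univ a)]
    · refine ⟨∑ a, (t⁻¹ * w a) • p a, ?_, ?_⟩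
      · refine (convex_convexHull ℝ _).sum_mem (fun a _ => ?_) ?_ fun a _ =>
          subset_convexHull ℝ _ ⟨a, rfl⟩
        · exact mul_nonneg (inv_nonneg.2 ht) (hw0 a)
        · rw [← Finset.mul_sum, hw1, inv_mul_cancel₀ ht'.ne']
      · simp [Finset.smul_sum, smul_smul, ht'.ne']

/-- Minkowski sums of dilated polytopes are slices of the Cayley cone. -/
lemma mem_sum_smul_convexHull_iff (V : Fin k → Finset (Fin d → ℤ)) (hV : ∀ i, (V i).Nonempty)
    (J : Finset (Fin k)) (n : ℕ) (z : Fin d → ℤ) :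
    (fun i => (z i : ℝ)) ∈ ∑ j ∈ J, (n : ℝ) •
        convexHull ℝ ((fun z : Fin d → ℤ => fun i => (z i : ℝ)) '' ↑(V j)) ↔
      ∃ x : (Σ i, V i) → ℝ, (∀ g, 0 ≤ x g) ∧
        ∑ g, x g • cayleyVector (Sigma.fst : (Σ i, V i) → Fin k) (fun g => g.2.1) g =
          latticeCast (fun i => ((if i ∈ J then n else 0 : ℕ) : ℤ)) z := by
  have hfst : ∀ (x : (Σ i, V i) → ℝ) i, (∑ g with g.1 = i, x g) = ∑ a, x ⟨i, a⟩ := by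
    intro x i
    rw [Finset.sum_filter, Fintype.sum_sigma, Finset.sum_eq_single i]
    · simp
    · intro j _ hj
      simp [hj]
    · simp
  rw [Set.mem_finsetSum]
  constructor
  · rintro ⟨y, hy, hyz⟩
    have hw : ∀ j, ∃ w : V j → ℝ, (∀ a, 0 ≤ w a) ∧ (∑ a, w a = if j ∈ J then (n : ℝ) else 0) ∧
        (∑ a, w a • (fun i => ((a : Fin d → ℤ) i : ℝ)) = if j ∈ J then y j else 0) := by
      intro j
      by_cases hj : j ∈ J
      · simpa [hj] using
          (mem_smul_convexHull_iff (hV j) _ (Nat.cast_nonneg n) (y j)).1 (hy hj)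
      · exact ⟨0, fun _ => le_rfl, by simp [hj], by simp [hj]⟩
    choose w hw0 hw1 hw2 using hw
    refine ⟨fun g => w g.1 g.2, fun g => hw0 _ _, ?_⟩
    ext i
    · rw [sum_smul_cayleyVector_fst, hfst, hw1]
      simp [latticeCast]
    · rw [sum_smul_cayleyVector_snd, Fintype.sum_sigma]
      have h1 : ∀ j, ∑ a, w j a * ((a : Fin d → ℤ) i : ℝ) = if j ∈ J then y j i else 0 := by
        intro j
        have h2 := congrFun (hw2 j) i
        simp only [Finset.sum_apply, Pi.smul_apply, smul_eq_mul] at h2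
        rw [h2]
        split_ifs <;> rfl
      simp only [h1, Finset.sum_ite_mem, Finset.univ_inter, latticeCast]
      rw [← congrFun hyz i, Finset.sum_apply]
  · rintro ⟨x, hx0, hx⟩
    refine ⟨fun j => ∑ a, x ⟨j, a⟩ • fun i => ((a : Fin d → ℤ) i : ℝ), fun {j} hj => ?_, ?_⟩
    · refine (mem_smul_convexHull_iff (hV j) _ (Nat.cast_nonneg n) _).2
        ⟨fun a => x ⟨j, a⟩, fun a => hx0 _, ?_, rfl⟩
      rw [← hfst, ← sum_smul_cayleyVector_fst, hx]
      simp [latticeCast, hj]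
    · have hzero : ∀ j ∉ J, ∀ a, x ⟨j, a⟩ = 0 := by
        intro j hj
        have h1 : ∑ a, x ⟨j, a⟩ = 0 := by
          rw [← hfst, ← sum_smul_cayleyVector_fst _ (fun g => g.2.1), hx]
          simp [latticeCast, hj]
        rw [Finset.sum_eq_zero_iff_of_nonneg fun a _ => hx0 _] at h1
        exact fun a => h1 a (Finset.mem_univ a)
      ext i
      have h2 := congrFun (congrArg Prod.snd hx) i
      rw [sum_smul_cayleyVector_snd, Fintype.sum_sigma] at h2
      rw [← Finset.sum_subset (Finset.subset_univ J) fun j _ hj => by simp [hzero j hj]] at h2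
      simpa [latticeCast, -Finset.univ_eq_attach] using h2

end CayleyGeometry

section CayleyDegree

lemma exists_linearIndependent_of_span_eq_top {E : Type*} [AddCommGroup E] [Module ℝ E]
    [FiniteDimensional ℝ E] : ∀ {k : ℕ}, k ≤ Module.finrank ℝ E → ∀ D : Fin k → Set E,
      (∀ i, Submodule.span ℝ (D i) = ⊤) →
      ∃ u : Fin k → E, (∀ i, u i ∈ D i) ∧ LinearIndependent ℝ u
  | 0, _, _, _ => ⟨Fin.elim0, fun i => i.elim0, linearIndependent_empty_type⟩
  | k + 1, hk, D, hD => by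
    obtain ⟨u, huD, hu⟩ := exists_linearIndependent_of_span_eq_top (k := k) (by omega)
      (fun i => D i.castSucc) fun i => hD _
    obtain ⟨v, hvD, hv⟩ : ∃ v ∈ D (Fin.last k), v ∉ Submodule.span ℝ (Set.range u) := by
      by_contra! h
      have htop : Submodule.span ℝ (Set.range u) = ⊤ := by
        rw [eq_top_iff, ← hD (Fin.last k)]
        exact Submodule.span_le.2 h
      have h1 := finrank_span_eq_card hu
      rw [htop, finrank_top, Fintype.card_fin] at h1
      omega
    refine ⟨Fin.snoc u v, fun i => ?_, linearIndependent_finSnoc.2 ⟨hu, hv⟩⟩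
    induction i using Fin.lastCases with
    | last => simpa using hvD
    | cast i => simpa using huD i

variable {k d : ℕ}

lemma span_cayleyVector_eq_top (hk : 1 ≤ k) (V : Fin k → Finset (Fin d → ℤ))
    (hV : ∀ i, (V i).Nonempty) (hspan : ∀ i, vectorSpan ℝ
      ((fun z : Fin d → ℤ => fun i => (z i : ℝ)) '' ↑(V i)) = ⊤) :
    Submodule.span ℝ (Set.range (cayleyVector (Sigma.fst : (Σ i, V i) → Fin k)
      fun g => g.2.1)) = ⊤ := by
  set W := Submodule.span ℝ (Set.range (cayleyVector (Sigma.fst : (Σ i, V i) → Fin k)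
      fun g => g.2.1)) with hW
  have hmem : ∀ g, cayleyVector (Sigma.fst : (Σ i, V i) → Fin k) (fun g => g.2.1) g ∈ W :=
    fun g => Submodule.subset_span ⟨g, rfl⟩
  have hsnd : ∀ y : Fin d → ℝ, ((0, y) : (Fin k → ℝ) × (Fin d → ℝ)) ∈ W := by
    have h1 : vectorSpan ℝ ((fun z : Fin d → ℤ => fun i => (z i : ℝ)) '' ↑(V ⟨0, hk⟩)) ≤
        W.comap (LinearMap.inr ℝ (Fin k → ℝ) (Fin d → ℝ)) := by
      rw [vectorSpan, Submodule.span_le]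
      rintro _ ⟨_, ⟨p, hp, rfl⟩, _, ⟨q, hq, rfl⟩, rfl⟩
      have h2 := W.sub_mem (hmem ⟨⟨0, hk⟩, p, hp⟩) (hmem ⟨⟨0, hk⟩, q, hq⟩)
      simpa [cayleyVector] using h2
    rw [hspan] at h1
    exact fun y => h1 (Submodule.mem_top (x := y))
  have hfst : ∀ i, ((Pi.single i 1, 0) : (Fin k → ℝ) × (Fin d → ℝ)) ∈ W := by
    intro i
    obtain ⟨p, hp⟩ := hV i
    have h2 := W.sub_mem (hmem ⟨i, p, hp⟩) (hsnd fun j => p j)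
    simpa [cayleyVector] using h2
  rw [eq_top_iff]
  rintro ⟨a, y⟩ -
  have h3 : (a, y) = ∑ i, a i • ((Pi.single i 1, 0) : (Fin k → ℝ) × (Fin d → ℝ)) + (0, y) := by
    ext i
    · simp [Prod.fst_sum, Finset.sum_apply, Pi.single_apply]
    · simp [Prod.snd_sum]
  rw [h3]
  exact W.add_mem (W.sum_mem fun i _ => W.smul_mem _ (hfst i)) (hsnd y)

/-- If `k ≤ d`, some linearly independent set of Cayley vectors uses every colour twice. -/
lemma exists_linearIndepOn_two_per_color (hkd : k ≤ d) (V : Fin k → Finset (Fin d → ℤ))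
    (hspan : ∀ i, vectorSpan ℝ
      ((fun z : Fin d → ℤ => fun i => (z i : ℝ)) '' ↑(V i)) = ⊤) :
    ∃ S : Set (Σ i, V i), LinearIndepOn ℝ (cayleyVector Sigma.fst fun g => g.2.1) S ∧
      ∀ i, ∃ g ∈ S, ∃ g' ∈ S, g ≠ g' ∧ g.1 = i ∧ g'.1 = i := by
  obtain ⟨u, huD, hu⟩ := exists_linearIndependent_of_span_eq_top (by simpa using hkd)
    (fun i => ((fun z : Fin d → ℤ => fun i => (z i : ℝ)) '' ↑(V i)) -ᵥ
      ((fun z : Fin d → ℤ => fun i => (z i : ℝ)) '' ↑(V i))) hspan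
  have hpq : ∀ i, ∃ p q : V i, u i = (fun j => (q.1 j : ℝ)) - fun j => (p.1 j : ℝ) := by
    intro i
    obtain ⟨_, ⟨q, hq, rfl⟩, _, ⟨p, hp, rfl⟩, h⟩ := huD i
    exact ⟨⟨p, hp⟩, ⟨q, hq⟩, h.symm⟩
  choose p q hpq using hpq
  let f : Fin k ⊕ Fin k → Σ i, V i := Sum.elim (fun i => ⟨i, p i⟩) fun i => ⟨i, q i⟩
  refine ⟨Set.range f, ?_, fun i => ⟨⟨i, p i⟩, ⟨Sum.inl i, rfl⟩, ⟨i, q i⟩, ⟨Sum.inr i, rfl⟩, ?_,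
    rfl, rfl⟩⟩
  · have hli : LinearIndependent ℝ
        ((cayleyVector (Sigma.fst : (Σ i, V i) → Fin k) fun g => g.2.1) ∘ f) := by
      rw [Fintype.linearIndependent_iff]
      intro c hc
      rw [Fintype.sum_sum_type] at hc
      have h1 : ∀ i, c (Sum.inl i) = -c (Sum.inr i) := by
        intro i
        have h := congrFun (congrArg Prod.fst hc) i
        simp [Prod.fst_sum, f, cayleyVector, Pi.single_apply] at h
        linarith
      have h2 : ∑ i, c (Sum.inr i) • u i = 0 := by
        have h := congrArg Prod.snd hc
        simp only [Prod.snd_add, Prod.snd_sum, Prod.smul_snd, f, cayleyVector, Function.comp,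
          Sum.elim_inl, Sum.elim_inr, h1] at h
        simp only [hpq, smul_sub, Finset.sum_sub_distrib]
        rw [sub_eq_neg_add]
        simpa using h
      have h3 := Fintype.linearIndependent_iff.1 hu _ h2
      rintro (i | i)
      · rw [h1, h3, neg_zero]
      · exact h3 i
    exact (linearIndepOn_range_iff hli.injective.of_comp _).2 hli
  · intro h
    have h1 : p i = q i := by simpa using h
    exact hu.ne_zero i (by rw [hpq, h1, sub_self])

end CayleyDegree

section CayleyDMV

lemma sum_alternating_prod {k : ℕ} (g : Fin k → ℕ → ℤ) (n : ℕ) :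
    ∑ J : Finset (Fin k), (-1) ^ (k - J.card) * ∏ i, g i (if i ∈ J then n else 0) =
      ∏ i, (g i n - g i 0) := by
  simp only [sub_eq_add_neg]
  rw [Fintype.prod_add]
  refine Finset.sum_congr rfl fun J _ => ?_
  rw [Finset.prod_neg, Finset.card_compl, Fintype.card_fin, ← Finset.prod_mul_prod_compl J]
  have h1 : ∏ i ∈ J, g i (if i ∈ J then n else 0) = ∏ i ∈ J, g i n :=
    Finset.prod_congr rfl fun i hi => by rw [if_pos hi]
  have h2 : ∏ i ∈ Jᶜ, g i (if i ∈ J then n else 0) = ∏ i ∈ Jᶜ, g i 0 :=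
    Finset.prod_congr rfl fun i hi => by rw [if_neg (Finset.mem_compl.1 hi)]
  rw [h1, h2]
  ring

lemma sum_alternating_sum_prod {k : ℕ} {ι α : Type*} (T : Finset ι) (F : ι → Finset α)
    (g : ι → α → Fin k → ℕ → ℕ) (n : ℕ) :
    ∑ J : Finset (Fin k), (-1) ^ (k - J.card) *
        ((∑ B ∈ T, ∑ f ∈ F B, ∏ i, g B f i (if i ∈ J then n else 0) : ℕ) : ℤ) =
      ∑ B ∈ T, ∑ f ∈ F B, ∏ i, ((g B f i n : ℤ) - g B f i 0) := by
  have h : ∀ B f, ∏ i, ((g B f i n : ℤ) - g B f i 0) = ∑ J : Finset (Fin k),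
      (-1) ^ (k - J.card) * ∏ i, (g B f i (if i ∈ J then n else 0) : ℤ) :=
    fun B f => (sum_alternating_prod (fun i m => (g B f i m : ℤ)) n).symm
  simp only [h]
  push_cast
  simp only [Finset.mul_sum]
  rw [Finset.sum_comm]
  exact Finset.sum_congr rfl fun B _ => Finset.sum_comm

/-- A forward difference of a shifted binomial coefficient has the full growth order. -/
lemma eventually_le_choose_sub (s b : ℕ) (hs : 2 ≤ s) (hb : b < s) :
    ∃ c : ℝ, 0 < c ∧ ∀ᶠ n : ℕ in atTop, c * (n : ℝ) ^ (s - 1) ≤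
      ((n + s - 1 - b).choose (s - 1) : ℝ) - ((0 + s - 1 - b).choose (s - 1) : ℝ) := by
  obtain ⟨r, rfl⟩ : ∃ r, s = r + 1 := ⟨s - 1, by omega⟩
  simp only [Nat.add_sub_cancel]
  have hr : r ≠ 0 := by omega
  refine ⟨1 / (2 * 2 ^ r * r.factorial), by positivity, ?_⟩
  have hlim : Tendsto (fun n : ℕ => 1 / (2 * 2 ^ r * (r.factorial : ℝ)) * (n : ℝ) ^ r)
      atTop atTop :=
    ((tendsto_pow_atTop hr).comp tendsto_natCast_atTop_atTop).const_mul_atTop (by positivity)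
  filter_upwards [hlim.eventually_ge_atTop 1, eventually_ge_atTop (2 * r)] with n hn1 hn2
  have h1 : ((0 + r - b).choose r : ℝ) ≤ 1 := by
    have : (0 + r - b).choose r ≤ r.choose r := Nat.choose_le_choose r (by omega)
    rw [Nat.choose_self] at this
    exact_mod_cast this
  have h2 : (n.choose r : ℝ) ≤ (n + (r + 1) - 1 - b).choose r := by
    exact_mod_cast Nat.choose_le_choose r (by omega)
  have h3 : ((n : ℝ) / 2) ^ r / r.factorial ≤ n.choose r := by
    refine le_trans ?_ (Nat.pow_le_choose r n)
    gcongr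
    rw [Nat.cast_sub (by omega)]
    have : (2 * r : ℝ) ≤ n := by exact_mod_cast hn2
    push_cast
    linarith
  have h4 : ((n : ℝ) / 2) ^ r / r.factorial =
      2 * (1 / (2 * 2 ^ r * (r.factorial : ℝ)) * (n : ℝ) ^ r) := by
    rw [div_pow]
    field_simp
  simp only [show 0 + (r + 1) - 1 - b = 0 + r - b by omega]
  linarith

end CayleyDMV

section MixedEhrhartGrowth

variable {k d : ℕ}

lemma IsLatticePolytope.vectorSpan_eq_top {P : Set (Fin d → ℝ)} {V : Finset (Fin d → ℤ)}
    (hP : P = convexHull ℝ ((fun z : Fin d → ℤ => fun i => (z i : ℝ)) '' ↑V))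
    (hdim : polytopeDim P = d) :
    vectorSpan ℝ ((fun z : Fin d → ℤ => fun i => (z i : ℝ)) '' ↑V) = ⊤ := by
  rw [polytopeDim, hP, affineSpan_convexHull, direction_affineSpan] at hdim
  exact Submodule.eq_top_of_finrank_eq (by simpa using hdim)

/-- The discrete mixed volume of the `n`-th dilates as a sum of products of forward differences of
binomial coefficients. -/
theorem exists_DMV_smul_eq_sum (hk : 1 ≤ k) (V : Fin k → Finset (Fin d → ℤ))
    (hV : ∀ i, (V i).Nonempty) (hspan : ∀ i, vectorSpan ℝ
      ((fun z : Fin d → ℤ => fun i => (z i : ℝ)) '' ↑(V i)) = ⊤) {S : Set (Σ i, V i)}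
    (hS : LinearIndepOn ℝ (cayleyVector Sigma.fst fun g => g.2.1) S) :
    ∃ (T : Finset (Finset (Σ i, V i))) (F : Finset (Σ i, V i) → Finset ((Σ i, V i) → ℝ))
      (β : Finset (Σ i, V i) → ((Σ i, V i) → ℝ) → Fin k → ℕ), (∃ B ∈ T, S ⊆ B) ∧
      (∀ B ∈ T, (F B).Nonempty ∧ (∀ i, 0 < (B.filter fun g => g.1 = i).card) ∧
        ∑ i, (B.filter fun g => g.1 = i).card = k + d ∧
        ∀ f ∈ F B, ∀ i, β B f i < (B.filter fun g => g.1 = i).card) ∧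
      ∀ n : ℕ, DMV (fun j => (n : ℝ) •
          convexHull ℝ ((fun z : Fin d → ℤ => fun i => (z i : ℝ)) '' ↑(V j))) =
        ∑ B ∈ T, ∑ f ∈ F B, ∏ i,
          (((n + (B.filter fun g => g.1 = i).card - 1 - β B f i).choose
            ((B.filter fun g => g.1 = i).card - 1) : ℤ) -
          ((0 + (B.filter fun g => g.1 = i).card - 1 - β B f i).choose
            ((B.filter fun g => g.1 = i).card - 1) : ℤ)) := by
  obtain ⟨T, F, β, hST, hT, hcount⟩ := exists_count_cayley_cone
    (Sigma.fst : (Σ i, V i) → Fin k) (fun g => g.2.1)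
    (span_cayleyVector_eq_top hk V hV hspan) hS
  refine ⟨T, F, β, hST, hT, fun n => ?_⟩
  rw [← sum_alternating_sum_prod T F fun B f i m =>
    (m + (B.filter fun g => g.1 = i).card - 1 - β B f i).choose
      ((B.filter fun g => g.1 = i).card - 1)]
  refine Finset.sum_congr rfl fun J _ => ?_
  rw [← hcount fun i => if i ∈ J then n else 0, latticePointCount]
  congr 3
  ext z
  exact mem_sum_smul_convexHull_iff V hV J n z

/-- The mixed Ehrhart polynomial of full-dimensional lattice polytopes either vanishes or has
full degree. -/
theorem DMV_smul_eq_zero_or_eventually_ge (hk : 1 ≤ k) (P : Fin k → Set (Fin d → ℝ))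
    (hP : ∀ i, IsLatticePolytope (P i)) (hPdim : ∀ i, polytopeDim (P i) = d) :
    (∀ n : ℕ, (DMV (fun i => (n : ℝ) • P i) : ℝ) = 0) ∨ ∃ c : ℝ, 0 < c ∧
      ∀ᶠ n : ℕ in atTop, c * (n : ℝ) ^ d ≤ (DMV (fun i => (n : ℝ) • P i) : ℝ) := by
  choose V hV hPV using hP
  have hspan := fun i => IsLatticePolytope.vectorSpan_eq_top (hPV i) (hPdim i)
  obtain rfl : P = fun j => convexHull ℝ ((fun z : Fin d → ℤ => fun i => (z i : ℝ)) '' ↑(V j)) :=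
    funext hPV
  rcases lt_or_ge d k with hdk | hkd
  · left
    obtain ⟨T, F, β, -, hT, hDMV⟩ := exists_DMV_smul_eq_sum hk V hV hspan (S := ∅)
      (linearIndepOn_empty _ _)
    intro n
    rw [hDMV, Int.cast_eq_zero]
    refine Finset.sum_eq_zero fun B hB => Finset.sum_eq_zero fun f hf => ?_
    obtain ⟨-, hpos, hsum, hβ⟩ := hT B hB
    obtain ⟨i, hi⟩ : ∃ i, (B.filter fun g => g.1 = i).card < 2 := by
      by_contra! h
      have h1 := Finset.sum_le_sum fun i (_ : i ∈ Finset.univ) => h i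
      rw [hsum] at h1
      simp at h1
      omega
    have h1 : (B.filter fun g => g.1 = i).card = 1 := by
      have := hpos i
      omega
    refine Finset.prod_eq_zero (Finset.mem_univ i) ?_
    simp [h1]
  · right
    obtain ⟨S, hS, hS2⟩ := exists_linearIndepOn_two_per_color hkd V hspan
    obtain ⟨T, F, β, ⟨B, hB, hSB⟩, hT, hDMV⟩ := exists_DMV_smul_eq_sum hk V hV hspan hS
    obtain ⟨⟨f, hf⟩, hpos, hsum, hβ⟩ := hT B hB
    have htwo : ∀ i, 2 ≤ (B.filter fun g => g.1 = i).card := by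
      intro i
      obtain ⟨g, hg, g', hg', hne, hgi, hgi'⟩ := hS2 i
      exact Finset.one_lt_card.2 ⟨g, Finset.mem_filter.2 ⟨hSB hg, hgi⟩, g',
        Finset.mem_filter.2 ⟨hSB hg', hgi'⟩, hne⟩
    have hgrowth := fun i => eventually_le_choose_sub _ (β B f i) (htwo i) (hβ f hf i)
    choose c hc0 hc using hgrowth
    refine ⟨∏ i, c i, Finset.prod_pos fun i _ => hc0 i, ?_⟩
    have hnonneg : ∀ (B : Finset (Σ i, V i)) f (n : ℕ) i, (0 : ℤ) ≤
        ((n + (B.filter fun g => g.1 = i).card - 1 - β B f i).choose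
            ((B.filter fun g => g.1 = i).card - 1) : ℤ) -
          ((0 + (B.filter fun g => g.1 = i).card - 1 - β B f i).choose
            ((B.filter fun g => g.1 = i).card - 1) : ℤ) := by
      intro B f n i
      rw [sub_nonneg]
      exact_mod_cast Nat.choose_le_choose _ (by omega)
    filter_upwards [eventually_all.2 hc] with n hn
    have hd : ∑ i, ((B.filter fun g => g.1 = i).card - 1) = d := by
      have h1 : ∑ i, ((B.filter fun g => g.1 = i).card - 1) + ∑ _i : Fin k, 1 = k + d := by
        rw [← Finset.sum_add_distrib, ← hsum]
        exact Finset.sum_congr rfl fun i _ => Nat.sub_add_cancel (hpos i)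
      simp at h1
      omega
    calc (∏ i, c i) * (n : ℝ) ^ d
        = ∏ i, (c i * (n : ℝ) ^ ((B.filter fun g => g.1 = i).card - 1)) := by
          rw [Finset.prod_mul_distrib, Finset.prod_pow_eq_pow_sum, hd]
      _ ≤ ((∏ i, (((n + (B.filter fun g => g.1 = i).card - 1 - β B f i).choose
            ((B.filter fun g => g.1 = i).card - 1) : ℤ) -
          ((0 + (B.filter fun g => g.1 = i).card - 1 - β B f i).choose
            ((B.filter fun g => g.1 = i).card - 1) : ℤ)) : ℤ) : ℝ) := by
          push_cast
          exact Finset.prod_le_prod (fun i _ => mul_nonneg (hc0 i).le (by positivity))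
            fun i _ => hn i
      _ ≤ _ := by
          rw [hDMV]
          refine Int.cast_le.2 ?_
          refine (Finset.single_le_sum (f := fun f => ∏ i,
            (((n + (B.filter fun g => g.1 = i).card - 1 - β B f i).choose
              ((B.filter fun g => g.1 = i).card - 1) : ℤ) -
            ((0 + (B.filter fun g => g.1 = i).card - 1 - β B f i).choose
              ((B.filter fun g => g.1 = i).card - 1) : ℤ)))
            (fun f _ => Finset.prod_nonneg fun i _ => hnonneg B f n i) hf).trans ?_
          exact Finset.single_le_sum (f := fun B => ∑ f ∈ F B, ∏ i,
            (((n + (B.filter fun g => g.1 = i).card - 1 - β B f i).choose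
              ((B.filter fun g => g.1 = i).card - 1) : ℤ) -
            ((0 + (B.filter fun g => g.1 = i).card - 1 - β B f i).choose
              ((B.filter fun g => g.1 = i).card - 1) : ℤ)))
            (fun B _ => Finset.sum_nonneg fun f _ =>
              Finset.prod_nonneg fun i _ => hnonneg B f n i) hB

end MixedEhrhartGrowth

/-- **Log-concavity and unimodality of the mixed `h^*`-vector of large dilates.**
Let `𝐏 = (P_1, …, P_k)` be a collection of `d`-dimensional lattice polytopes in `ℝ^d`.
For `r ≥ 1` let `h r` be the mixed `h^*`-vector of `r𝐏 = (rP_1, …, rP_k)`, so that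
`ME_{r𝐏}(n) = DMV(rn P_1, …, rn P_k) = ∑_{i=0}^d h r i binom(n + d - i, d)`.
Then there is `R ≥ 1` such that for all `r ≥ R` the sequence `(h r 0, …, h r d)` is
log-concave (`(h r i)^2 ≥ h r (i-1) ⬝ h r (i+1)` for `1 ≤ i ≤ d - 1`) and unimodal
(it increases up to some index `ℓ ≤ d` and decreases afterwards). -/
theorem mixed_hstar_log_concave_unimodal_of_large_dilates
    {d k : ℕ} (hk : 1 ≤ k) (P : Fin k → Set (Fin d → ℝ))
    (hP : ∀ i, IsLatticePolytope (P i))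
    (hPdim : ∀ i, polytopeDim (P i) = d)
    (h : ℕ → ℕ → ℝ)
    (hh : ∀ r : ℕ, 1 ≤ r → ∀ n : ℕ,
      (DMV (fun i => ((r * n : ℕ) : ℝ) • P i) : ℝ)
        = ∑ i ∈ Finset.range (d + 1), h r i * ((n + d - i).choose d : ℕ)) :
    ∃ R : ℕ, 1 ≤ R ∧ ∀ r : ℕ, R ≤ r →
      (∀ i : ℕ, 1 ≤ i → i + 1 ≤ d → h r (i - 1) * h r (i + 1) ≤ (h r i) ^ 2) ∧
      ∃ l : ℕ, l ≤ d ∧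
        (∀ i j : ℕ, i ≤ j → j ≤ l → h r i ≤ h r j) ∧
        (∀ i j : ℕ, l ≤ i → i ≤ j → j ≤ d → h r j ≤ h r i) := by
  exact logConcave_unimodal_of_growth _ h hh (DMV_smul_eq_zero_or_eventually_ge hk P hP hPdim)
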